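/- arXiv:1710.10922 — 8 statements merged into one kernel-verified Lean document; each statement's English description precedes it below -/
import Mathlib

section
/- Let q ≥ 2 be an integer, β > 0, C₀ > 0, and let p, p' be conjugate exponents with 1 ≤ p' < 2 < p ≤ ∞ (1/p + 1/p' = 1). There exist constants β' > 0 and C > 0, depending only on q, β, C₀, p, such that the following holds. Let G be any finite (q+1)-regular Ramanujan graph with vertex set V and let N be an integer with 1 ≤ N ≤ log_q |V| such that Condition (★★) holds with constants β, C₀ and the integer N. Then for every even integer 2 ≤ n ≤ N and every function f : V → ℝ, ‖P_n(T_q/2) Π f‖_p ≤ C · q^{−β' · n} · ‖f‖_{p'}. -/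
open Finset ENNReal

/-- The normalized adjacency operator `T_q f (x) = q^{-1/2} ∑_{y ~ x} f(y)`. -/
noncomputable def Tq {V : Type*} [Fintype V] (q : ℕ) (G : SimpleGraph V)
    [DecidableRel G.Adj] (f : V → ℝ) : V → ℝ :=
  fun x => (Real.sqrt q)⁻¹ * ∑ y ∈ G.neighborFinset x, f y

/-- The sphere-averaging operators: `S_0 = Id`, `S_1 = T_q`,
`S_2 = T_q ∘ S_1 - (1 + 1/q)·Id`, `S_{n+1} = T_q ∘ S_n - S_{n-1}` for `n ≥ 2`. -/
noncomputable def Sop {V : Type*} [Fintype V] (q : ℕ) (G : SimpleGraph V)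
    [DecidableRel G.Adj] : ℕ → (V → ℝ) → (V → ℝ)
  | 0 => fun f => f
  | 1 => fun f => Tq q G f
  | 2 => fun f x => Tq q G (Tq q G f) x - (1 + 1 / (q : ℝ)) * f x
  | (n + 3) => fun f x => Tq q G (Sop q G (n + 2) f) x - Sop q G (n + 1) f x

/-- The kernel `K_n(x,y) = (S_n δ_y)(x)`. -/
noncomputable def Kker {V : Type*} [Fintype V] [DecidableEq V] (q : ℕ) (G : SimpleGraph V)
    [DecidableRel G.Adj] (n : ℕ) (x y : V) : ℝ :=
  Sop q G n (fun z => if z = y then 1 else 0) x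

/-- Condition (★★): `max_{x,y} |K_n(x,y)| ≤ C₀ · q^{-βn}` for all `1 ≤ n ≤ N`. -/
def CondStarStar {V : Type*} [Fintype V] [DecidableEq V] (q : ℕ) (G : SimpleGraph V)
    [DecidableRel G.Adj] (β C₀ : ℝ) (N : ℕ) : Prop :=
  ∀ n : ℕ, 1 ≤ n → n ≤ N → ∀ x y : V,
    |Kker q G n x y| ≤ C₀ * (q : ℝ) ^ (-(β * (n : ℝ)))

/-- `G` is Ramanujan: the spectrum of `T_q` is contained in `[-2,2] ∪ {(q+1)/√q}`, and the
eigenspace of the eigenvalue `(q+1)/√q` consists exactly of the constant functions. -/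
def IsRamanujan {V : Type*} [Fintype V] (q : ℕ) (G : SimpleGraph V)
    [DecidableRel G.Adj] : Prop :=
  (∀ (f : V → ℝ) (lam : ℝ), f ≠ 0 → (Tq q G f = fun x => lam * f x) →
      lam ∈ Set.Icc (-2 : ℝ) 2 ∨ lam = ((q : ℝ) + 1) / Real.sqrt q) ∧
  (∀ f : V → ℝ, (Tq q G f = fun x => ((q : ℝ) + 1) / Real.sqrt q * f x) →
      ∃ a : ℝ, f = fun _ => a)

/-- The `ℓ^p` norm with respect to counting measure: `(∑_x |f(x)|^p)^{1/p}`. -/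
noncomputable def lpN {V : Type*} [Fintype V] (p : ℝ) (f : V → ℝ) : ℝ :=
  (∑ x, |f x| ^ p) ^ (1 / p)


/-- The projection onto the orthogonal complement of the constants:
`Πf = f - (1/|V|) ∑_y f(y)`. -/
noncomputable def Pproj {V : Type*} [Fintype V] (f : V → ℝ) : V → ℝ :=
  fun x => f x - (∑ y, f y) / (Fintype.card V)

/-- The `ℓ^p` norm for an extended-real exponent `p` (counting measure on `V`):
for finite `p` it is `(∑_x |f(x)|^p)^{1/p}`, and for `p = ∞` it is `max_x |f(x)|`. -/
noncomputable def gNorm {V : Type*} [Fintype V] (p : ℝ≥0∞) (f : V → ℝ) : ℝ :=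
  if p = ⊤ then ⨆ x, |f x| else (∑ x, |f x| ^ p.toReal) ^ (1 / p.toReal)


/-- The operator `P_m(T_q/2)`, where `P_m` is the degree-`m` Chebyshev polynomial of the first
kind (`P_m(cos θ) = cos(mθ)`), applied to the operator `T_q/2` via the Chebyshev recurrence
`P_0 = 1`, `P_1 = x`, `P_{m+2}(x) = 2x·P_{m+1}(x) - P_m(x)`. -/
noncomputable def chebOp {V : Type*} [Fintype V] (q : ℕ) (G : SimpleGraph V)
    [DecidableRel G.Adj] : ℕ → (V → ℝ) → (V → ℝ)
  | 0 => fun f => f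
  | 1 => fun f x => (1 / 2) * Tq q G f x
  | (m + 2) => fun f x => Tq q G (chebOp q G (m + 1) f) x - chebOp q G m f x

section NormalizedAdjacency

variable {V : Type*} [Fintype V] (q : ℕ) (G : SimpleGraph V) [DecidableRel G.Adj]

lemma Tq_eq_mulVec [DecidableEq V] (f : V → ℝ) :
    Tq q G f = ((Real.sqrt q)⁻¹ • G.adjMatrix ℝ).mulVec f := by
  ext x
  simp [Tq, Matrix.smul_mulVec]

lemma Tq_add (f g : V → ℝ) : Tq q G (f + g) = Tq q G f + Tq q G g := by
  ext x
  simp [Tq, Finset.sum_add_distrib, mul_add]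

lemma Tq_sub (f g : V → ℝ) : Tq q G (f - g) = Tq q G f - Tq q G g := by
  ext x
  simp [Tq, Finset.sum_sub_distrib, mul_sub]

lemma Tq_smul (c : ℝ) (f : V → ℝ) : Tq q G (c • f) = c • Tq q G f := by
  ext x
  simp [Tq, ← Finset.mul_sum, mul_left_comm]

lemma Tq_dotProduct (f g : V → ℝ) : Tq q G f ⬝ᵥ g = f ⬝ᵥ Tq q G g := by
  classical
  have h : ((Real.sqrt q)⁻¹ • G.adjMatrix ℝ).transpose = (Real.sqrt q)⁻¹ • G.adjMatrix ℝ := by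
    simp
  rw [Tq_eq_mulVec, Tq_eq_mulVec, Matrix.dotProduct_mulVec, ← Matrix.mulVec_transpose, h]

/-- The sphere-averaging operators are given by a matrix. -/
lemma exists_Sop_eq_mulVec [DecidableEq V] (n : ℕ) :
    ∃ A : Matrix V V ℝ, ∀ f, Sop q G n f = A.mulVec f := by
  induction n using Nat.strong_induction_on with
  | _ n ih =>
    match n, ih with
    | 0, _ => exact ⟨1, fun f => by simp [Sop]⟩
    | 1, _ => exact ⟨_, fun f => Tq_eq_mulVec q G f⟩
    | 2, _ =>
      refine ⟨((Real.sqrt q)⁻¹ • G.adjMatrix ℝ) * ((Real.sqrt q)⁻¹ • G.adjMatrix ℝ)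
        - (1 + 1 / (q : ℝ)) • 1, fun f => ?_⟩
      rw [Matrix.sub_mulVec, ← Matrix.mulVec_mulVec, Matrix.smul_mulVec _ 1, Matrix.one_mulVec,
        ← Tq_eq_mulVec, ← Tq_eq_mulVec]
      rfl
    | n + 3, ih =>
      obtain ⟨A, hA⟩ := ih (n + 2) (by omega)
      obtain ⟨B, hB⟩ := ih (n + 1) (by omega)
      refine ⟨((Real.sqrt q)⁻¹ • G.adjMatrix ℝ) * A - B, fun f => ?_⟩
      rw [Matrix.sub_mulVec, ← Matrix.mulVec_mulVec, ← hA, ← hB, ← Tq_eq_mulVec]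
      rfl

lemma Sop_eq_sum_Kker [DecidableEq V] (n : ℕ) (f : V → ℝ) (x : V) :
    Sop q G n f x = ∑ y, Kker q G n x y * f y := by
  obtain ⟨A, hA⟩ := exists_Sop_eq_mulVec q G n
  have hK : ∀ y, Kker q G n x y = A x y := fun y => by
    rw [Kker, hA]
    simp [Matrix.mulVec, dotProduct]
  simp only [hK, hA]
  rfl

lemma abs_Sop_le [DecidableEq V] {n : ℕ} {ε : ℝ} (h : ∀ x y, |Kker q G n x y| ≤ ε)
    (f : V → ℝ) (x : V) : |Sop q G n f x| ≤ ε * ∑ y, |f y| := by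
  rw [Sop_eq_sum_Kker, Finset.mul_sum]
  refine (Finset.abs_sum_le_sum_abs _ _).trans (Finset.sum_le_sum fun y _ => ?_)
  rw [abs_mul]
  exact mul_le_mul_of_nonneg_right (h x y) (abs_nonneg _)

lemma chebOp_succ_succ (n : ℕ) (f : V → ℝ) :
    chebOp q G (n + 2) f = Tq q G (chebOp q G (n + 1) f) - chebOp q G n f := rfl

lemma Sop_add_three (n : ℕ) (f : V → ℝ) :
    Sop q G (n + 3) f = Tq q G (Sop q G (n + 2) f) - Sop q G (n + 1) f := rfl

lemma chebOp_one (f : V → ℝ) : chebOp q G 1 f = (1 / 2 : ℝ) • Tq q G f := rfl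

lemma chebOp_add (n : ℕ) (f g : V → ℝ) :
    chebOp q G n (f + g) = chebOp q G n f + chebOp q G n g := by
  induction n using Nat.twoStepInduction with
  | zero => rfl
  | one => rw [chebOp_one, chebOp_one, chebOp_one, Tq_add, smul_add]
  | more n h0 h1 =>
    rw [chebOp_succ_succ, chebOp_succ_succ, chebOp_succ_succ, h0, h1, Tq_add]
    abel

lemma Sop_two (f : V → ℝ) :
    Sop q G 2 f = Tq q G (Tq q G f) - (1 + (q : ℝ)⁻¹) • f := by
  ext x
  simp [Sop]

lemma two_chebOp_two (f : V → ℝ) :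
    (2 : ℝ) • chebOp q G 2 f = Sop q G 2 f - (1 - (q : ℝ)⁻¹) • f := by
  have h : chebOp q G 2 f = Tq q G (chebOp q G 1 f) - f := rfl
  rw [h, Sop_two, chebOp_one, Tq_smul]
  module

/-- The Chebyshev operators `2 P_n(T_q/2)` and the sphere-averaging operators are related by a
two-step recurrence. -/
lemma two_chebOp_add_three (n : ℕ) (f : V → ℝ) :
    (2 : ℝ) • chebOp q G (n + 3) f =
      (q : ℝ)⁻¹ • (2 : ℝ) • chebOp q G (n + 1) f + Sop q G (n + 3) f - Sop q G (n + 1) f := by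
  induction n using Nat.twoStepInduction with
  | zero =>
    rw [chebOp_succ_succ, smul_sub, ← Tq_smul, two_chebOp_two, Sop_add_three, zero_add]
    simp only [chebOp_one, Tq_sub, Tq_smul, Sop]
    module
  | one =>
    have h3 : Sop q G 3 f = Tq q G (Sop q G 2 f) - Tq q G f := rfl
    have h4 : Sop q G 4 f = Tq q G (Sop q G 3 f) - Sop q G 2 f := rfl
    have c4 : chebOp q G 4 f = Tq q G (chebOp q G 3 f) - chebOp q G 2 f := rfl
    have c3 : chebOp q G 3 f = Tq q G (chebOp q G 2 f) - chebOp q G 1 f := rfl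
    have c2 : chebOp q G 2 f = Tq q G (chebOp q G 1 f) - f := rfl
    rw [show 1 + 3 = 4 from rfl, show 1 + 1 = 2 from rfl, h4, h3, Sop_two, c4, c3, c2, chebOp_one]
    simp only [Tq_sub, Tq_smul]
    module
  | more n h0 h1 =>
    have hc : chebOp q G (n + 3) f = Tq q G (chebOp q G (n + 2) f) - chebOp q G (n + 1) f := rfl
    have hc' : (2 : ℝ) • chebOp q G (n + 5) f =
        Tq q G ((2 : ℝ) • chebOp q G (n + 4) f) - (2 : ℝ) • chebOp q G (n + 3) f := by
      rw [Tq_smul, ← smul_sub]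
      rfl
    have h5 : Sop q G (n + 5) f = Tq q G (Sop q G (n + 4) f) - Sop q G (n + 3) f := rfl
    have h3 : Sop q G (n + 3) f = Tq q G (Sop q G (n + 2) f) - Sop q G (n + 1) f := rfl
    rw [show n + 1 + 3 = n + 4 from rfl, show n + 1 + 1 = n + 2 from rfl] at h1
    rw [show n + 2 + 3 = n + 5 from rfl, show n + 2 + 1 = n + 3 from rfl, hc', h1, h5]
    nth_rewrite 1 [h0]
    rw [hc]
    simp only [Tq_sub, Tq_add, Tq_smul]
    rw [h3]
    module

lemma chebOp_dotProduct_of_eigenvector {e : V → ℝ} {c : ℝ} (he : Tq q G e = c • e)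
    (n : ℕ) (f : V → ℝ) :
    chebOp q G n f ⬝ᵥ e = (Polynomial.Chebyshev.T ℝ n).eval (c / 2) * (f ⬝ᵥ e) := by
  induction n using Nat.twoStepInduction with
  | zero => simp [chebOp]
  | one =>
    rw [chebOp_one, smul_dotProduct, Tq_dotProduct, he, dotProduct_smul]
    simp
    ring
  | more n h0 h1 =>
    rw [chebOp_succ_succ, sub_dotProduct, Tq_dotProduct, he, dotProduct_smul, h0, h1]
    push_cast
    rw [Polynomial.Chebyshev.T_add_two]
    simp
    ring

lemma sum_Pproj (f : V → ℝ) : ∑ x, Pproj f x = 0 := by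
  cases isEmpty_or_nonempty V
  · simp
  · simp only [Pproj, Finset.sum_sub_distrib, Finset.sum_const, Finset.card_univ, nsmul_eq_mul]
    field_simp
    simp

lemma Pproj_add (f g : V → ℝ) : Pproj (f + g) = Pproj f + Pproj g := by
  ext x
  simp only [Pproj, Pi.add_apply, Finset.sum_add_distrib]
  ring

lemma sum_sq_Pproj_le (f : V → ℝ) : ∑ x, Pproj f x ^ 2 ≤ ∑ x, f x ^ 2 := by
  have h : ∑ x, f x ^ 2 = ∑ x, Pproj f x ^ 2 + (2 * ((∑ y, f y) / Fintype.card V)) *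
      ∑ x, Pproj f x + ∑ _x : V, ((∑ y, f y) / Fintype.card V) ^ 2 := by
    rw [Finset.mul_sum, ← Finset.sum_add_distrib, ← Finset.sum_add_distrib]
    refine Finset.sum_congr rfl fun x _ => ?_
    rw [Pproj]
    ring
  rw [h, sum_Pproj, mul_zero, add_zero]
  exact le_add_of_nonneg_right (Finset.sum_nonneg fun _ _ => sq_nonneg _)

lemma sum_abs_Pproj_le (f : V → ℝ) : ∑ x, |Pproj f x| ≤ 2 * ∑ x, |f x| := by
  have h : ∑ x, |Pproj f x| ≤ ∑ x, (|f x| + |(∑ y, f y) / Fintype.card V|) :=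
    Finset.sum_le_sum fun x _ => abs_sub _ _
  refine h.trans ?_
  rw [Finset.sum_add_distrib, two_mul]
  refine add_le_add le_rfl ?_
  cases isEmpty_or_nonempty V
  · simp
  · rw [Finset.sum_const, Finset.card_univ, nsmul_eq_mul, abs_div, Nat.abs_cast,
      mul_div_cancel₀ _ (by positivity)]
    exact Finset.abs_sum_le_sum_abs _ _

/-- On a Ramanujan graph, `P_n(T_q/2)Π` is a contraction of `ℓ²`. -/
lemma sum_sq_chebOp_Pproj_le [DecidableEq V] (hG : IsRamanujan q G) (n : ℕ) (f : V → ℝ) :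
    ∑ x, chebOp q G n (Pproj f) x ^ 2 ≤ ∑ x, f x ^ 2 := by
  refine le_trans ?_ (sum_sq_Pproj_le f)
  have hM : ((Real.sqrt q)⁻¹ • G.adjMatrix ℝ).IsHermitian := by
    ext
    simp [Matrix.conjTranspose_apply, SimpleGraph.adj_comm]
  have hnorm : ∀ g : V → ℝ, ∑ x, g x ^ 2 = ∑ j, (g ⬝ᵥ ⇑(hM.eigenvectorBasis j)) ^ 2 := by
    intro g
    have h := hM.eigenvectorBasis.sum_sq_norm_inner_left (WithLp.toLp 2 g)
    rw [EuclideanSpace.norm_sq_eq] at h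
    simp only [Real.norm_eq_abs, sq_abs] at h
    rw [← h]
    refine Finset.sum_congr rfl fun j _ => ?_
    rw [EuclideanSpace.inner_eq_star_dotProduct]
    simp [dotProduct_comm]
  rw [hnorm, hnorm (Pproj f)]
  refine Finset.sum_le_sum fun j _ => ?_
  have he := hM.mulVec_eigenvectorBasis j
  rw [← Tq_eq_mulVec] at he
  rw [chebOp_dotProduct_of_eigenvector q G he, mul_pow]
  have hne : (⇑(hM.eigenvectorBasis j) : V → ℝ) ≠ 0 := by
    intro h
    exact hM.eigenvectorBasis.orthonormal.ne_zero j (by ext x; exact congrFun h x)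
  rcases hG.1 _ _ hne he with h | h
  · refine mul_le_of_le_one_left (sq_nonneg _) ?_
    rw [sq_le_one_iff_abs_le_one]
    refine Polynomial.Chebyshev.abs_eval_T_real_le_one n ?_
    rw [abs_le]
    constructor <;> linarith [h.1, h.2]
  · rw [h] at he
    obtain ⟨a, ha⟩ := hG.2 _ he
    have h0 : Pproj f ⬝ᵥ ⇑(hM.eigenvectorBasis j) = 0 := by
      rw [ha, dotProduct, ← Finset.sum_mul, sum_Pproj, zero_mul]
    simp [h0]

/-- Decay of the sphere-averaging operators gives decay of the even Chebyshev operators. -/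
lemma abs_chebOp_le [DecidableEq V] {ρ C₀ : ℝ} {N : ℕ} (hρ : 0 < ρ) (hρ1 : ρ ≤ 1)
    (hq : (q : ℝ)⁻¹ < ρ ^ 2) (hC₀ : 0 < C₀)
    (h : ∀ n, 1 ≤ n → n ≤ N → ∀ x y, |Kker q G n x y| ≤ C₀ * ρ ^ n)
    (f : V → ℝ) (x : V) (m : ℕ) (hm : 2 * (m + 1) ≤ N) :
    |2 * chebOp q G (2 * (m + 1)) f x| ≤
      (C₀ + (ρ ^ 2)⁻¹ + 2 * C₀ / (ρ ^ 2 - (q : ℝ)⁻¹)) * ρ ^ (2 * (m + 1)) * ∑ y, |f y| := by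
  have hd : 0 < ρ ^ 2 - (q : ℝ)⁻¹ := sub_pos.2 hq
  have hF : 0 ≤ ∑ y, |f y| := Finset.sum_nonneg fun _ _ => abs_nonneg _
  have hq0 : (0 : ℝ) ≤ (q : ℝ)⁻¹ := by positivity
  have hρ2 : ρ ^ 2 ≤ 1 := pow_le_one₀ hρ.le hρ1
  set K := C₀ + (ρ ^ 2)⁻¹ + 2 * C₀ / (ρ ^ 2 - (q : ℝ)⁻¹) with hK
  induction m with
  | zero =>
    have h1 : 2 * chebOp q G 2 f x = Sop q G 2 f x - (1 - (q : ℝ)⁻¹) * f x :=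
      congrFun (two_chebOp_two q G f) x
    have hS := abs_Sop_le q G (h 2 (by norm_num) hm) f x
    have hf : |f x| ≤ ∑ y, |f y| :=
      Finset.single_le_sum (f := fun y => |f y|) (fun _ _ => abs_nonneg _) (Finset.mem_univ x)
    rw [show 2 * (0 + 1) = 2 from rfl, h1]
    have hbound : |Sop q G 2 f x - (1 - (q : ℝ)⁻¹) * f x| ≤
        (C₀ * ρ ^ 2) * ∑ y, |f y| + 1 * ∑ y, |f y| := by
      refine (abs_sub _ _).trans (add_le_add hS ?_)
      rw [abs_mul]
      refine mul_le_mul ?_ hf (abs_nonneg _) zero_le_one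
      rw [abs_le]
      constructor <;> linarith
    refine hbound.trans ?_
    rw [← add_mul]
    refine mul_le_mul_of_nonneg_right ?_ hF
    have : K * ρ ^ 2 = C₀ * ρ ^ 2 + 1 + 2 * C₀ / (ρ ^ 2 - (q : ℝ)⁻¹) * ρ ^ 2 := by
      rw [hK]
      field_simp
    rw [this]
    exact le_add_of_nonneg_right (by positivity)
  | succ m ih =>
    have ih := ih (by omega)
    set n := 2 * m + 1 with hn
    have e1 : 2 * (m + 1) = n + 1 := by omega
    have e2 : 2 * (m + 1 + 1) = n + 3 := by omega
    rw [e1] at ih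
    rw [e2] at hm ⊢
    have h1 : 2 * chebOp q G (n + 3) f x = (q : ℝ)⁻¹ * (2 * chebOp q G (n + 1) f x) +
        Sop q G (n + 3) f x - Sop q G (n + 1) f x :=
      congrFun (two_chebOp_add_three q G n f) x
    have hS1 := abs_Sop_le q G (h (n + 1) (by omega) (by omega)) f x
    have hS3 := abs_Sop_le q G (h (n + 3) (by omega) hm) f x
    rw [h1]
    have hbound : |(q : ℝ)⁻¹ * (2 * chebOp q G (n + 1) f x) +
        Sop q G (n + 3) f x - Sop q G (n + 1) f x| ≤
        (q : ℝ)⁻¹ * (K * ρ ^ (n + 1) * ∑ y, |f y|) + C₀ * ρ ^ (n + 3) * ∑ y, |f y| +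
          C₀ * ρ ^ (n + 1) * ∑ y, |f y| := by
      refine (abs_sub _ _).trans (add_le_add ((abs_add_le _ _).trans (add_le_add ?_ hS3)) hS1)
      rw [abs_mul, abs_of_nonneg hq0]
      exact mul_le_mul_of_nonneg_left ih hq0
    refine hbound.trans ?_
    have hKd : 2 * C₀ ≤ K * (ρ ^ 2 - (q : ℝ)⁻¹) := by
      rw [hK, add_mul _ _ (ρ ^ 2 - (q : ℝ)⁻¹), div_mul_cancel₀ _ hd.ne']
      exact le_add_of_nonneg_left (by positivity)
    have hP : 0 ≤ ρ ^ (n + 1) * ∑ y, |f y| := by positivity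
    have hpow : ρ ^ (n + 3) = ρ ^ (n + 1) * ρ ^ 2 := by ring
    have hle : (q : ℝ)⁻¹ * K + C₀ * ρ ^ 2 + C₀ ≤ K * ρ ^ 2 := by nlinarith
    calc _ = ((q : ℝ)⁻¹ * K + C₀ * ρ ^ 2 + C₀) * (ρ ^ (n + 1) * ∑ y, |f y|) := by
          rw [hpow]; ring
      _ ≤ K * ρ ^ 2 * (ρ ^ (n + 1) * ∑ y, |f y|) := mul_le_mul_of_nonneg_right hle hP
      _ = _ := by rw [hpow]; ring

end NormalizedAdjacency

section Interpolation

variable {V : Type*} [Fintype V]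

lemma sum_rpow_le_of_abs_le {s u B : ℝ} (hs : 0 < s) (hsu : s ≤ u)
    {g : V → ℝ} (hg : ∀ x, |g x| ≤ B) :
    ∑ x, |g x| ^ u ≤ B ^ (u - s) * ∑ x, |g x| ^ s := by
  rw [Finset.mul_sum]
  refine Finset.sum_le_sum fun x _ => ?_
  have h : |g x| ^ u = |g x| ^ (u - s) * |g x| ^ s := by
    rw [← Real.rpow_add' (abs_nonneg _) (by linarith), sub_add_cancel]
  rw [h]
  gcongr
  exact hg x

lemma lpN_nonneg (r : ℝ) (f : V → ℝ) : 0 ≤ lpN r f :=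
  Real.rpow_nonneg (Finset.sum_nonneg fun _ _ => Real.rpow_nonneg (abs_nonneg _) _) _

lemma lpN_rpow {r : ℝ} (hr : 0 < r) (f : V → ℝ) : lpN r f ^ r = ∑ x, |f x| ^ r := by
  rw [lpN, one_div, Real.rpow_inv_rpow _ hr.ne']
  exact Finset.sum_nonneg fun _ _ => Real.rpow_nonneg (abs_nonneg _) _

lemma abs_le_lpN {r : ℝ} (hr : 0 < r) (f : V → ℝ) (x : V) : |f x| ≤ lpN r f := by
  rw [← Real.rpow_le_rpow_iff (abs_nonneg _) (lpN_nonneg r f) hr, lpN_rpow hr]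
  exact Finset.single_le_sum (f := fun x => |f x| ^ r)
    (fun _ _ => Real.rpow_nonneg (abs_nonneg _) _) (Finset.mem_univ x)

lemma sum_sq_le_rpow_mul {r B : ℝ} (hr : 0 < r) (hr2 : r ≤ 2) {g : V → ℝ}
    (hg : ∀ x, |g x| ≤ B) : ∑ x, g x ^ 2 ≤ B ^ (2 - r) * ∑ x, |g x| ^ r := by
  simpa using sum_rpow_le_of_abs_le hr hr2 hg

lemma sum_sq_le_lpN_sq {r : ℝ} (hr : 0 < r) (hr2 : r ≤ 2) (f : V → ℝ) :
    ∑ x, f x ^ 2 ≤ lpN r f ^ 2 := by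
  refine (sum_sq_le_rpow_mul hr hr2 (abs_le_lpN hr f)).trans_eq ?_
  rw [← lpN_rpow hr, ← Real.rpow_add' (lpN_nonneg r f) (by norm_num), sub_add_cancel,
    Real.rpow_two]

/-- An additive operator that is bounded `ℓ¹ → ℓ^∞` with small norm and contracting on `ℓ²` is
bounded `ℓ^r → ℓ^∞` with small norm, for every `1 ≤ r < 2`. -/
lemma abs_apply_le_lpN {A : (V → ℝ) → V → ℝ} (hadd : ∀ f g, A (f + g) = A f + A g)
    {K ε r : ℝ} (hK : 0 ≤ K) (hε : 0 < ε) (hε1 : ε ≤ 1) (hr : 1 ≤ r) (hr2 : r < 2)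
    (h1 : ∀ f x, |A f x| ≤ K * ε * ∑ y, |f y|)
    (h2 : ∀ f, ∑ x, A f x ^ 2 ≤ ∑ x, f x ^ 2) (f : V → ℝ) (x : V) :
    |A f x| ≤ (K + 1) * ε ^ ((2 - r) / 4) * lpN r f := by
  have hr0 : 0 < r := by linarith
  rcases (lpN_nonneg r f).eq_or_lt with hF | hF
  · have hz : ∀ y, |f y| = 0 := fun y =>
      le_antisymm ((abs_le_lpN hr0 f y).trans_eq hF.symm) (abs_nonneg _)
    have := h1 f x
    simp only [hz, Finset.sum_const_zero, mul_zero] at this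
    rw [← hF, mul_zero]
    exact this
  set F := lpN r f with hFdef
  set t := ε ^ (1 / 2 : ℝ) with ht
  have ht0 : 0 < t := Real.rpow_pos_of_pos hε _
  have htF : 0 < t * F := mul_pos ht0 hF
  set g : V → ℝ := fun y => if |f y| ≤ t * F then 0 else f y with hg
  set k : V → ℝ := fun y => if |f y| ≤ t * F then f y else 0 with hk
  have hfgk : f = g + k := by
    ext y
    simp only [hg, hk, Pi.add_apply]
    split_ifs <;> simp
  have hgsum : ∑ y, |g y| ≤ t ^ (1 - r) * F := by
    have hle : ∀ y, |g y| ≤ (t * F) ^ (1 - r) * |f y| ^ r := by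
      intro y
      simp only [hg]
      split_ifs with hy
      · simp only [abs_zero]
        positivity
      · have hy' : t * F < |f y| := not_le.1 hy
        have : |f y| = |f y| ^ (1 - r) * |f y| ^ r := by
          rw [← Real.rpow_add (htF.trans hy'), sub_add_cancel, Real.rpow_one]
        nth_rewrite 1 [this]
        refine mul_le_mul_of_nonneg_right ?_ (by positivity)
        exact Real.rpow_le_rpow_of_nonpos htF hy'.le (by linarith)
    refine (Finset.sum_le_sum fun y _ => hle y).trans_eq ?_
    rw [← Finset.mul_sum, ← lpN_rpow hr0, ← hFdef, Real.mul_rpow ht0.le hF.le, mul_assoc,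
      ← Real.rpow_add hF, sub_add_cancel, Real.rpow_one]
  have hksum : ∑ y, k y ^ 2 ≤ t ^ (2 - r) * F ^ 2 := by
    have hkle : ∀ y, |k y| ≤ t * F := by
      intro y
      simp only [hk]
      split_ifs with hy
      · exact hy
      · simpa using htF.le
    refine (sum_sq_le_rpow_mul hr0 hr2.le hkle).trans ?_
    have hkf : ∑ y, |k y| ^ r ≤ F ^ r := by
      rw [hFdef, lpN_rpow hr0]
      refine Finset.sum_le_sum fun y _ => Real.rpow_le_rpow (abs_nonneg _) ?_ hr0.le
      simp only [hk]
      split_ifs <;> simp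
    refine (mul_le_mul_of_nonneg_left hkf (by positivity)).trans_eq ?_
    rw [Real.mul_rpow ht0.le hF.le, mul_assoc, ← Real.rpow_add hF, sub_add_cancel, Real.rpow_two]
  have hAg : |A g x| ≤ K * ε ^ ((2 - r) / 4) * F := by
    calc |A g x| ≤ K * ε * ∑ y, |g y| := h1 g x
      _ ≤ K * ε * (t ^ (1 - r) * F) := by gcongr
      _ = K * ε ^ ((3 - r) / 2) * F := by
        have : ε * t ^ (1 - r) = ε ^ ((3 - r) / 2) := by
          rw [ht, ← Real.rpow_mul hε.le]
          nth_rewrite 1 [← Real.rpow_one ε]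
          rw [← Real.rpow_add hε]
          ring_nf
        rw [← this]
        ring
      _ ≤ K * ε ^ ((2 - r) / 4) * F := by
        gcongr K * ?_ * F
        exact Real.rpow_le_rpow_of_exponent_ge hε hε1 (by linarith)
  have hAk : |A k x| ≤ ε ^ ((2 - r) / 4) * F := by
    refine abs_le_of_sq_le_sq ?_ (mul_nonneg (Real.rpow_nonneg hε.le _) hF.le)
    calc A k x ^ 2 ≤ ∑ y, A k y ^ 2 :=
          Finset.single_le_sum (f := fun y => A k y ^ 2) (fun _ _ => sq_nonneg _)
            (Finset.mem_univ x)
      _ ≤ t ^ (2 - r) * F ^ 2 := (h2 k).trans hksum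
      _ = _ := by
        rw [mul_pow, ht, ← Real.rpow_mul hε.le, ← Real.rpow_natCast (ε ^ _) 2,
          ← Real.rpow_mul hε.le]
        push_cast
        ring_nf
  calc |A f x| = |A g x + A k x| := by rw [hfgk, hadd]; rfl
    _ ≤ |A g x| + |A k x| := abs_add_le _ _
    _ ≤ _ := by linarith

lemma gNorm_eq_lpN {p : ℝ≥0∞} (hp : p ≠ ⊤) (f : V → ℝ) : gNorm p f = lpN p.toReal f := by
  rw [gNorm, if_neg hp, lpN]

lemma gNorm_le_of_abs_le {p : ℝ≥0∞} (hp : 2 < p) {M F : ℝ} (hM : 0 ≤ M) (hF : 0 ≤ F)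
    {h : V → ℝ} (hsup : ∀ x, |h x| ≤ M * F) (hsq : ∑ x, h x ^ 2 ≤ F ^ 2) :
    gNorm p h ≤ M ^ (1 - 2 / p.toReal) * F := by
  by_cases hp' : p = ⊤
  · subst hp'
    simpa [gNorm] using Real.iSup_le hsup (mul_nonneg hM hF)
  have hp2 : 2 < p.toReal := by
    simpa using (ENNReal.toReal_lt_toReal (by simp) hp').2 hp
  have hp0 : 0 < p.toReal := by linarith
  rw [gNorm_eq_lpN hp', ← Real.rpow_le_rpow_iff (lpN_nonneg _ _) (by positivity) hp0,
    lpN_rpow hp0]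
  have h1 := sum_rpow_le_of_abs_le (two_pos (α := ℝ)) hp2.le hsup
  simp only [Real.rpow_two, sq_abs] at h1
  refine h1.trans ((mul_le_mul_of_nonneg_left hsq (by positivity)).trans_eq ?_)
  rw [Real.mul_rpow hM hF, Real.mul_rpow (by positivity) hF, ← Real.rpow_mul hM, mul_assoc,
    ← Real.rpow_two F, ← Real.rpow_add' hF (by simpa using hp0.ne'), sub_add_cancel]
  congr 2
  field_simp

end Interpolation

theorem statement5 (q : ℕ) (hq : 2 ≤ q) (β C₀ : ℝ) (hβ : 0 < β) (hC₀ : 0 < C₀)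
    (p p' : ℝ≥0∞) (hp'1 : 1 ≤ p') (hp'2 : p' < 2) (hp2 : 2 < p)
    (hconj : 1 / p + 1 / p' = 1) :
    ∃ β' C : ℝ, 0 < β' ∧ 0 < C ∧
      ∀ (V : Type) [Fintype V] [DecidableEq V] (G : SimpleGraph V) [DecidableRel G.Adj],
        G.IsRegularOfDegree (q + 1) → IsRamanujan q G →
        ∀ N : ℕ, 1 ≤ N → (N : ℝ) ≤ Real.logb q (Fintype.card V) →
          CondStarStar q G β C₀ N →
          ∀ n : ℕ, 2 ≤ n → Even n → n ≤ N → ∀ f : V → ℝ,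
            gNorm p (chebOp q G n (Pproj f)) ≤ C * (q : ℝ) ^ (-(β' * (n : ℝ))) * gNorm p' f := by
  have hq1 : (1 : ℝ) < q := by exact_mod_cast hq
  have hq0 : (0 : ℝ) < q := by linarith
  set b := min β (1 / 4) with hb
  have hb0 : 0 < b := lt_min hβ (by norm_num)
  set ρ : ℝ := (q : ℝ) ^ (-b) with hρdef
  have hρ : 0 < ρ := Real.rpow_pos_of_pos hq0 _
  have hρ1 : ρ ≤ 1 := Real.rpow_le_one_of_one_le_of_nonpos hq1.le (by linarith)
  have hρn : ∀ n : ℕ, ρ ^ n = (q : ℝ) ^ (-(b * (n : ℝ))) := fun n => by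
    rw [hρdef, ← Real.rpow_natCast, ← Real.rpow_mul hq0.le, neg_mul]
  have hρ2 : (q : ℝ)⁻¹ < ρ ^ 2 := by
    rw [hρn, ← Real.rpow_neg_one]
    refine Real.rpow_lt_rpow_of_exponent_lt hq1 ?_
    have : b ≤ 1 / 4 := min_le_right _ _
    push_cast
    linarith
  set K := C₀ + (ρ ^ 2)⁻¹ + 2 * C₀ / (ρ ^ 2 - (q : ℝ)⁻¹) with hKdef
  have hK : 0 ≤ K := by
    have := sub_pos.2 hρ2
    positivity
  have hp't : p' ≠ ⊤ := (hp'2.trans_le le_top).ne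
  set r := p'.toReal with hrdef
  have hr1 : 1 ≤ r := by simpa using (ENNReal.toReal_le_toReal (by simp) hp't).2 hp'1
  have hr2 : r < 2 := by simpa using (ENNReal.toReal_lt_toReal hp't (by simp)).2 hp'2
  set θ := 1 - 2 / p.toReal with hθdef
  have hθ : 0 < θ := by
    by_cases hp : p = ⊤
    · simp [hθdef, hp]
    · have hp2' : 2 < p.toReal := by
        simpa using (ENNReal.toReal_lt_toReal (by simp) hp).2 hp2
      rw [hθdef, sub_pos, div_lt_one (by linarith)]
      exact hp2'
  refine ⟨b * ((2 - r) / 4) * θ, (K + 1) ^ θ, ?_, by positivity, ?_⟩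
  · have : 0 < 2 - r := by linarith
    positivity
  intro V _ _ G _ _ hRam N _ _ hstar n hn heven hnN f
  have hker : ∀ m, 1 ≤ m → m ≤ N → ∀ x y, |Kker q G m x y| ≤ C₀ * ρ ^ m := by
    intro m hm hmN x y
    refine (hstar m hm hmN x y).trans ?_
    rw [hρn]
    refine mul_le_mul_of_nonneg_left (Real.rpow_le_rpow_of_exponent_le hq1.le ?_) hC₀.le
    exact neg_le_neg (mul_le_mul_of_nonneg_right (min_le_left _ _) (Nat.cast_nonneg _))
  obtain ⟨m, rfl⟩ : ∃ m, n = 2 * (m + 1) := by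
    obtain ⟨m, rfl⟩ := heven
    exact ⟨m - 1, by omega⟩
  set n := 2 * (m + 1)
  have h1 : ∀ g x, |chebOp q G n (Pproj g) x| ≤ K * ρ ^ n * ∑ y, |g y| := by
    intro g x
    have h := abs_chebOp_le q G hρ hρ1 hρ2 hC₀ hker (Pproj g) x m hnN
    rw [abs_mul, abs_two] at h
    have h' := mul_le_mul_of_nonneg_left (sum_abs_Pproj_le g)
      (mul_nonneg hK (pow_nonneg hρ.le n))
    linarith
  have hsup := abs_apply_le_lpN (A := fun g => chebOp q G n (Pproj g))
    (fun g k => by rw [Pproj_add, chebOp_add]) hK (pow_pos hρ n) (pow_le_one₀ hρ.le hρ1)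
    hr1 hr2 h1 (sum_sq_chebOp_Pproj_le q G hRam n) f
  have hsq := (sum_sq_chebOp_Pproj_le q G hRam n f).trans
    (sum_sq_le_lpN_sq (by linarith : 0 < r) hr2.le f)
  rw [gNorm_eq_lpN hp't]
  refine (gNorm_le_of_abs_le hp2 (by positivity) (lpN_nonneg r f) hsup hsq).trans_eq ?_
  rw [Real.mul_rpow (by positivity) (by positivity), hρn, ← Real.rpow_mul hq0.le,
    ← Real.rpow_mul hq0.le, ← hθdef]
  congr 3
  ring
end

section
/- For every real α ∈ [0, π] and every integer N ≥ 10, one has Σ_{n=1}^N cos²(nα) ≥ 0.3·N. -/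
theorem four_mul_sin_mul_sum_cos_sq (α : ℝ) (N : ℕ) :
    4 * Real.sin α * ∑ n ∈ Finset.Icc 1 N, Real.cos ((n : ℝ) * α) ^ 2 =
      (2 * N - 1) * Real.sin α + Real.sin ((2 * N + 1) * α) := by
  induction N with
  | zero => simp
  | succ k ih =>
    rw [Finset.sum_Icc_succ_top (by omega), mul_add, ih]
    push_cast
    have h1 : (2 * (k : ℝ) + 1) * α = 2 * ((k + 1) * α) - α := by ring
    have h2 : (2 * ((k : ℝ) + 1) + 1) * α = 2 * ((k + 1) * α) + α := by ring
    rw [h1, h2, Real.sin_sub, Real.sin_add, Real.cos_two_mul]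
    ring

theorem one_le_mul_sin_pi_div {M : ℝ} (hM : 21 ≤ M) :
    1 ≤ (0.4 * M - 1.4) * Real.sin (Real.pi / M) := by
  have hM0 : 0 < M := by linarith
  obtain ⟨y, hy⟩ : ∃ y, y = 1 / M := ⟨_, rfl⟩
  have hy0 : 0 < y := by rw [hy]; positivity
  have hyM : M * y = 1 := by rw [hy]; field_simp
  have hy1 : y ≤ 1 / 21 := by nlinarith
  have hpi := Real.pi_gt_d2
  have hdiv : Real.pi / M = Real.pi * y := by rw [hy]; ring
  have hmono : Real.sin (3.14 * y) ≤ Real.sin (Real.pi / M) := by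
    rw [hdiv]
    apply Real.sin_le_sin_of_le_of_le_pi_div_two <;> nlinarith
  have hsin : 3.14 * y - (3.14 * y) ^ 3 / 6 < Real.sin (3.14 * y) :=
    Real.sin_gt_sub_cube (by positivity)
  have hcoef : 0 ≤ 0.4 * M - 1.4 := by linarith
  have hsq : y ^ 2 ≤ 1 / 441 := by nlinarith
  have hpoly : (0.4 * M - 1.4) * (3.14 * y - (3.14 * y) ^ 3 / 6) =
      (0.4 - 1.4 * y) * (3.14 - 3.14 ^ 3 / 6 * y ^ 2) := by
    linear_combination (0.4 * (3.14 - 3.14 ^ 3 / 6 * y ^ 2)) * hyM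
  calc (1 : ℝ) ≤ (1 / 3) * 3.1 := by norm_num
    _ ≤ (0.4 - 1.4 * y) * (3.14 - 3.14 ^ 3 / 6 * y ^ 2) := by
        apply mul_le_mul <;> linarith
    _ = _ := hpoly.symm
    _ ≤ _ := mul_le_mul_of_nonneg_left (hsin.le.trans hmono) hcoef

theorem le_sum_cos_sq_of_le_pi_div_two {α : ℝ} (h0 : 0 ≤ α) (h1 : α ≤ Real.pi / 2) {N : ℕ}
    (hN : 10 ≤ N) :
    0.3 * (N : ℝ) ≤ ∑ n ∈ Finset.Icc 1 N, Real.cos ((n : ℝ) * α) ^ 2 := by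
  have hN' : (10 : ℝ) ≤ N := by exact_mod_cast hN
  rcases h0.eq_or_lt with rfl | hpos
  · simp
    linarith
  have hs : 0 < Real.sin α := Real.sin_pos_of_pos_of_lt_pi hpos (by linarith [Real.pi_pos])
  refine le_of_mul_le_mul_left ?_ (mul_pos four_pos hs)
  rw [four_mul_sin_mul_sum_cos_sq]
  have hM : (0 : ℝ) < 2 * N + 1 := by linarith
  rcases le_total ((2 * N + 1) * α) Real.pi with h | h
  · have := Real.sin_nonneg_of_nonneg_of_le_pi (mul_nonneg hM.le h0) h
    nlinarith
  · have hle : Real.pi / (2 * N + 1) ≤ α := by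
      rw [div_le_iff₀ hM]
      linarith
    have hsin : Real.sin (Real.pi / (2 * N + 1)) ≤ Real.sin α :=
      Real.sin_le_sin_of_le_of_le_pi_div_two
        (by linarith [Real.pi_pos, div_pos Real.pi_pos hM]) h1 hle
    have hbound := one_le_mul_sin_pi_div (M := 2 * N + 1) (by linarith)
    have hmul := mul_le_mul_of_nonneg_left hsin
      (by linarith : (0 : ℝ) ≤ 0.4 * (2 * N + 1) - 1.4)
    linarith [Real.neg_one_le_sin ((2 * N + 1) * α)]

theorem cos_nat_mul_pi_sub_sq (n : ℕ) (α : ℝ) :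
    Real.cos (n * (Real.pi - α)) ^ 2 = Real.cos (n * α) ^ 2 := by
  rw [mul_sub, Real.cos_nat_mul_pi_sub, mul_pow, ← pow_mul, mul_comm n 2, pow_mul]
  simp

theorem statement6 (α : ℝ) (hα : α ∈ Set.Icc 0 Real.pi) (N : ℕ) (hN : 10 ≤ N) :
    0.3 * (N : ℝ) ≤ ∑ n ∈ Finset.Icc 1 N, Real.cos ((n : ℝ) * α) ^ 2 := by
  obtain ⟨h0, h1⟩ := hα
  rcases le_total α (Real.pi / 2) with h | h
  · exact le_sum_cos_sq_of_le_pi_div_two h0 h hN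
  · simpa only [cos_nat_mul_pi_sub_sq] using
      le_sum_cos_sq_of_le_pi_div_two (sub_nonneg.2 h1) (by linarith) hN
end

section
/- Let q ≥ 2 be an integer, let T be the (q+1)-regular tree with vertex set V, fix a vertex o ∈ V, and write |x| = d(o, x) for the graph distance. Let δ_o be the indicator function of o and let n be a positive even integer. Then for every vertex x: (P_n(T_q/2) δ_o)(x) = 0 if |x| is odd or |x| > n; (P_n(T_q/2) δ_o)(x) = (1−q)/(2 q^{n/2}) if |x| < n and |x| is even; and (P_n(T_q/2) δ_o)(x) = 1/(2 q^{n/2}) if |x| = n. -/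
open Finset

/-- The normalized adjacency operator on a locally finite graph:
`T_q f (x) = q^{-1/2} ∑_{y ~ x} f(y)`. -/
noncomputable def TqT {V : Type*} (q : ℕ) (G : SimpleGraph V) [G.LocallyFinite]
    (f : V → ℝ) : V → ℝ :=
  fun x => (Real.sqrt q)⁻¹ * ∑ y ∈ G.neighborFinset x, f y

/-- The operator `P_m(T_q/2)`, where `P_m` is the degree-`m` Chebyshev polynomial of the first
kind (`P_m(cos θ) = cos(mθ)`), applied to the operator `T_q/2` via the Chebyshev recurrence
`P_0 = 1`, `P_1 = x`, `P_{m+2}(x) = 2x·P_{m+1}(x) - P_m(x)`. -/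
noncomputable def chebOpT {V : Type*} (q : ℕ) (G : SimpleGraph V) [G.LocallyFinite] :
    ℕ → (V → ℝ) → (V → ℝ)
  | 0 => fun f => f
  | 1 => fun f x => (1 / 2) * TqT q G f x
  | (m + 2) => fun f x => TqT q G (chebOpT q G (m + 1) f) x - chebOpT q G m f x

/-- In a tree, exactly one neighbor of a vertex `x ≠ o` is closer to `o` than `x`; all the
others are farther away. -/
theorem SimpleGraph.IsTree.exists_adj_dist_add_one {V : Type*} {G : SimpleGraph V}
    (hG : G.IsTree) {o x : V} (hx : x ≠ o) :
    ∃ p, G.Adj x p ∧ G.dist o x = G.dist o p + 1 ∧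
      ∀ y, G.Adj x y → y ≠ p → G.dist o y = G.dist o x + 1 := by
  obtain ⟨w, hw, hlen⟩ := hG.connected.exists_path_of_dist o x
  have hnil : ¬ w.Nil := fun h => hx h.eq.symm
  refine ⟨w.penultimate, (w.adj_penultimate hnil).symm, ?_, fun y hy hne => ?_⟩
  · have hle := G.dist_le w.dropLast
    have hdrop : w.dropLast.length + 1 = w.length := w.length_dropLast_add_one hnil
    have := hG.dist_eq_dist_add_one_of_adj o (w.adj_penultimate hnil)
    omega
  · have hns : y ∉ w.support := fun h =>
      hne (hG.isAcyclic.eq_penultimate_of_adj_end hw hy h)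
    obtain ⟨v, hv, hvlen⟩ := hG.connected.exists_path_of_dist o y
    have := (hG.existsUnique_path o y).unique hv (hw.concat hns hy)
    rw [← hvlen, this, SimpleGraph.Walk.length_concat, hlen]

/-- The operator `T_q` on radial functions, away from the origin. -/
theorem TqT_radial {V : Type*} {q : ℕ} {G : SimpleGraph V} [G.LocallyFinite]
    (hG : G.IsTree) (hreg : G.IsRegularOfDegree (q + 1)) {o x : V} {d : ℕ}
    (hx : G.dist o x = d + 1) (g : ℕ → ℝ) :
    TqT q G (fun z => g (G.dist o z)) x = (Real.sqrt q)⁻¹ * (g d + q * g (d + 2)) := by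
  classical
  have hne : x ≠ o := by
    rintro rfl
    simp at hx
  obtain ⟨p, hp, hpd, hy⟩ := hG.exists_adj_dist_add_one hne
  have hmem : p ∈ G.neighborFinset x := by simpa using hp
  have hcard : ((G.neighborFinset x).erase p).card = q := by
    rw [Finset.card_erase_of_mem hmem, G.card_neighborFinset_eq_degree, hreg x]
    rfl
  have hsum : ∑ y ∈ (G.neighborFinset x).erase p, g (G.dist o y) = q * g (d + 2) := by
    rw [Finset.sum_congr rfl (g := fun _ => g (d + 2)), Finset.sum_const, hcard, nsmul_eq_mul]
    intro y h
    rw [Finset.mem_erase, SimpleGraph.mem_neighborFinset] at h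
    rw [hy y h.2 h.1, hx]
  have hpd' : G.dist o p = d := by omega
  rw [TqT, ← Finset.add_sum_erase _ _ hmem, hsum, hpd']

/-- The operator `T_q` on radial functions, at the origin. -/
theorem TqT_radial_origin {V : Type*} {q : ℕ} {G : SimpleGraph V} [G.LocallyFinite]
    (hreg : G.IsRegularOfDegree (q + 1)) (o : V) (g : ℕ → ℝ) :
    TqT q G (fun z => g (G.dist o z)) o = (Real.sqrt q)⁻¹ * ((q + 1) * g 1) := by
  rw [TqT, Finset.sum_congr rfl (g := fun _ => g 1), Finset.sum_const,
    G.card_neighborFinset_eq_degree, hreg o, nsmul_eq_mul]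
  · push_cast
    rfl
  · intro y h
    rw [SimpleGraph.mem_neighborFinset] at h
    rw [SimpleGraph.dist_eq_one_iff_adj.2 h]

/-- The value of `P_m(T_q/2) δ_o` at distance `d` from `o`, where `s = √q`. -/
noncomputable def chebRadial (s : ℝ) (m d : ℕ) : ℝ :=
  if d = m then (if m = 0 then 1 else 1 / (2 * s ^ m))
  else if d < m ∧ Even (m + d) then (1 - s ^ 2) / (2 * s ^ m)
  else 0

theorem chebRadial_self (s : ℝ) {m : ℕ} (hm : m ≠ 0) :
    chebRadial s m m = 1 / (2 * s ^ m) := by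
  rw [chebRadial, if_pos rfl, if_neg hm]

theorem chebRadial_of_lt (s : ℝ) {m d : ℕ} (h : d < m) (he : Even (m + d)) :
    chebRadial s m d = (1 - s ^ 2) / (2 * s ^ m) := by
  rw [chebRadial, if_neg h.ne, if_pos ⟨h, he⟩]

theorem chebRadial_of_gt (s : ℝ) {m d : ℕ} (h : m < d) : chebRadial s m d = 0 := by
  rw [chebRadial, if_neg h.ne', if_neg fun h' => h.not_gt h'.1]

theorem chebRadial_of_odd (s : ℝ) {m d : ℕ} (h : Odd (m + d)) : chebRadial s m d = 0 := by
  rw [chebRadial, if_neg (by grind), if_neg fun h' => Nat.not_even_iff_odd.2 h h'.2]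

theorem chebRadial_add_two_zero {s : ℝ} (hs : s ≠ 0) (m : ℕ) :
    chebRadial s (m + 2) 0 =
      s⁻¹ * ((s ^ 2 + 1) * chebRadial s (m + 1) 1) - chebRadial s m 0 := by
  rcases m.even_or_odd with h | h
  · rw [chebRadial_of_lt s (by omega) (by grind)]
    rcases m with _ | m
    · rw [zero_add, zero_add, chebRadial_self s one_ne_zero]
      simp only [chebRadial, if_true]
      field_simp
      ring
    · have : m ≠ 0 := by grind
      rw [chebRadial_of_lt s (by omega) (by grind), chebRadial_of_lt s (by omega) (by grind)]
      field_simp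
      ring
  · rw [chebRadial_of_odd s (by grind), chebRadial_of_odd s (by grind),
      chebRadial_of_odd s (by grind)]
    ring

theorem chebRadial_add_two_succ {s : ℝ} (hs : s ≠ 0) (m d : ℕ) :
    chebRadial s (m + 2) (d + 1) =
      s⁻¹ * (chebRadial s (m + 1) d + s ^ 2 * chebRadial s (m + 1) (d + 2)) -
        chebRadial s m (d + 1) := by
  rcases (m + d).even_or_odd with h | h
  · rw [chebRadial_of_odd s (by grind), chebRadial_of_odd s (by grind),
      chebRadial_of_odd s (by grind), chebRadial_of_odd s (by grind)]
    ring
  obtain hlt | rfl | rfl | hgt : d + 1 < m ∨ m = d + 1 ∨ d = m + 1 ∨ m + 1 < d := by grind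
  · rw [chebRadial_of_lt s (by omega) (by grind), chebRadial_of_lt s (by omega) (by grind),
      chebRadial_of_lt s (by omega) (by grind), chebRadial_of_lt s hlt (by grind)]
    field_simp
    ring
  · rw [chebRadial_of_lt s (by omega) (by grind), chebRadial_of_lt s (by omega) (by grind),
      chebRadial_self s (by omega), chebRadial_self s (by omega)]
    field_simp
    ring
  · rw [chebRadial_self s (by omega), chebRadial_self s (by omega),
      chebRadial_of_gt s (by omega), chebRadial_of_gt s (by omega)]
    field_simp
    ring
  · rw [chebRadial_of_gt s (by omega), chebRadial_of_gt s (by omega),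
      chebRadial_of_gt s (by omega), chebRadial_of_gt s (by omega)]
    ring

/-- `P_m(T_q/2) δ_o` is radial with profile `chebRadial √q m`. -/
theorem chebOpT_delta {V : Type*} [DecidableEq V] {q : ℕ} (hq : 0 < q)
    {G : SimpleGraph V} [G.LocallyFinite] (hG : G.IsTree)
    (hreg : G.IsRegularOfDegree (q + 1)) (o : V) (m : ℕ) :
    chebOpT q G m (fun z => if z = o then 1 else 0) =
      fun x => chebRadial (Real.sqrt q) m (G.dist o x) := by
  have hs : Real.sqrt q ≠ 0 := by positivity
  have hs2 : Real.sqrt q ^ 2 = q := Real.sq_sqrt q.cast_nonneg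
  have hzero (x : V) : G.dist o x = 0 ↔ x = o := by
    rw [hG.connected.dist_eq_zero_iff, eq_comm]
  have hdelta : (fun z => if z = o then (1 : ℝ) else 0) =
      fun x => chebRadial (Real.sqrt q) 0 (G.dist o x) := by
    funext x
    by_cases hx : x = o <;> simp [chebRadial, hzero, hx]
  induction m using Nat.twoStepInduction with
  | zero => exact hdelta
  | one =>
    funext x
    simp only [chebOpT]
    rw [hdelta]
    rcases hd : G.dist o x with _ | d
    · rw [(hzero x).1 hd, TqT_radial_origin hreg o (chebRadial _ 0)]
      simp [chebRadial]
    · rw [TqT_radial hG hreg hd (chebRadial _ 0)]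
      rcases d with _ | d <;> simp [chebRadial]
      ring
  | more m ih ih' =>
    funext x
    simp only [chebOpT]
    rw [ih, ih']
    rcases hd : G.dist o x with _ | d
    · rw [(hzero x).1 hd, TqT_radial_origin hreg o (chebRadial _ (m + 1)),
        chebRadial_add_two_zero hs, hs2]
      simp only [SimpleGraph.dist_self]
    · rw [TqT_radial hG hreg hd (chebRadial _ (m + 1)), chebRadial_add_two_succ hs, hs2]
      simp only [hd]

theorem statement8 (q : ℕ) (hq : 2 ≤ q) {V : Type*} [DecidableEq V]
    (G : SimpleGraph V) [G.LocallyFinite]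
    (htree : G.IsTree) (hreg : G.IsRegularOfDegree (q + 1)) (o : V)
    (n : ℕ) (hn : 0 < n) (hev : Even n) (x : V) :
    (Odd (G.dist o x) ∨ n < G.dist o x →
        chebOpT q G n (fun z => if z = o then 1 else 0) x = 0) ∧
    (G.dist o x < n → Even (G.dist o x) →
        chebOpT q G n (fun z => if z = o then 1 else 0) x
          = (1 - (q : ℝ)) / (2 * (q : ℝ) ^ (n / 2))) ∧
    (G.dist o x = n →
        chebOpT q G n (fun z => if z = o then 1 else 0) x
          = 1 / (2 * (q : ℝ) ^ (n / 2))) := by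
  rw [chebOpT_delta (by omega) htree hreg]
  have hs2 : Real.sqrt q ^ 2 = q := Real.sq_sqrt q.cast_nonneg
  have hpow : (q : ℝ) ^ (n / 2) = Real.sqrt q ^ n := by
    rw [← hs2, ← pow_mul, Nat.two_mul_div_two_of_even hev, hs2]
  rw [hpow]
  refine ⟨fun h => ?_, fun h he => ?_, fun h => ?_⟩
  · rcases h with h | h
    · exact chebRadial_of_odd _ (hev.add_odd h)
    · exact chebRadial_of_gt _ h
  · simp only [chebRadial_of_lt _ h (hev.add he), hs2]
  · simp only [h, chebRadial_self _ hn.ne']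
end

section
/- Let q ≥ 2 be an integer and let n ≥ 2 be an even integer. Then one has the identity of polynomials in ℝ[x]: P_n(x/2) = ((1−q)/(2 q^{n/2})) · Σ_{k=0}^{n/2 − 1} q^k · p_{2k}(x) + (1/2) · p_n(x). -/
open Polynomial

/-- The polynomials `p_0 = 1`, `p_1 = X`, `p_2 = X² - (1+1/q)`,
`p_{n+1} = X·p_n - p_{n-1}` for `n ≥ 2` (so that `S_n = p_n(T_q)` on a `(q+1)`-regular graph). -/
noncomputable def pq (q : ℕ) : ℕ → Polynomial ℝ
  | 0 => 1
  | 1 => X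
  | 2 => X ^ 2 - C (1 + 1 / (q : ℝ))
  | (n + 3) => X * pq q (n + 2) - pq q (n + 1)

open Polynomial.Chebyshev in
theorem pq_eq_S_sub (q : ℕ) :
    ∀ n : ℕ, pq q (n + 1) =
      S ℝ ((n : ℤ) + 1) - Polynomial.C (1 / (q : ℝ)) * S ℝ ((n : ℤ) - 1)
  | 0 => by simp [pq]
  | 1 => by
    have h : S ℝ (((1 : ℕ) : ℤ) + 1) = X ^ 2 - 1 := S_two ℝ
    rw [h]
    simp [pq]
    ring
  | n + 2 => by
    have h₁ := pq_eq_S_sub q (n + 1)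
    have h₀ := pq_eq_S_sub q n
    have e₁ := S_add_two ℝ ((n : ℤ) + 1)
    have e₀ := S_add_two ℝ ((n : ℤ) - 1)
    rw [pq, h₁, h₀]
    push_cast
    ring_nf at e₁ e₀ ⊢
    rw [e₁, e₀]
    ring

open Polynomial.Chebyshev in
theorem sum_pow_mul_pq_even (q : ℕ) (hq : q ≠ 0) (m : ℕ) :
    ∑ k ∈ Finset.range (m + 1), Polynomial.C ((q : ℝ) ^ k) * pq q (2 * k) =
      Polynomial.C ((q : ℝ) ^ m) * S ℝ (2 * (m : ℤ)) := by
  induction m with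
  | zero => simp [pq]
  | succ m ih =>
    have h := pq_eq_S_sub q (2 * m + 1)
    have hC : Polynomial.C ((q : ℝ) ^ (m + 1)) * Polynomial.C (1 / (q : ℝ)) =
        Polynomial.C ((q : ℝ) ^ m) := by
      rw [← Polynomial.C_mul]
      congr 1
      have : (q : ℝ) ≠ 0 := Nat.cast_ne_zero.mpr hq
      field_simp
      ring
    rw [Finset.sum_range_succ, ih, show 2 * (m + 1) = 2 * m + 1 + 1 by ring, h, mul_sub,
      ← mul_assoc, hC]
    push_cast
    ring_nf

open Polynomial.Chebyshev in
theorem T_comp_half_mul_X_eq_S_sub (n : ℤ) :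
    (T ℝ n).comp (Polynomial.C (1 / 2 : ℝ) * X) =
      Polynomial.C (1 / 2 : ℝ) * (S ℝ n - S ℝ (n - 2)) := by
  have h := C_eq_two_mul_T_comp_half_mul_X ℝ n
  rw [C_eq_S_sub_X_mul_S] at h
  rw [S_sub_two]
  rw [invOf_eq_inv, inv_eq_one_div] at h
  have h₂ : Polynomial.C (1 / 2 : ℝ) * 2 = 1 := by
    rw [← map_ofNat Polynomial.C 2, ← Polynomial.C_mul]
    norm_num
  linear_combination (-Polynomial.C (1 / 2 : ℝ)) * h -
    (T ℝ n).comp (Polynomial.C (1 / 2 : ℝ) * X) * h₂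

theorem statement9 (q : ℕ) (hq : 2 ≤ q) (n : ℕ) (hn : 2 ≤ n) (hev : Even n) :
    (Polynomial.Chebyshev.T ℝ (n : ℤ)).comp (C (1 / 2 : ℝ) * X) =
      C ((1 - (q : ℝ)) / (2 * (q : ℝ) ^ (n / 2))) *
          ∑ k ∈ Finset.range (n / 2), C ((q : ℝ) ^ k) * pq q (2 * k)
        + C (1 / 2 : ℝ) * pq q n := by
  obtain ⟨m, rfl⟩ : ∃ m, n = 2 * m + 2 := by
    obtain ⟨k, rfl⟩ := hev
    exact ⟨k - 1, by omega⟩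
  have hq₀ : (q : ℝ) ≠ 0 := Nat.cast_ne_zero.mpr (by omega)
  rw [show (2 * m + 2) / 2 = m + 1 by omega, sum_pow_mul_pq_even q (by omega) m,
    pq_eq_S_sub q (2 * m + 1), T_comp_half_mul_X_eq_S_sub, ← mul_assoc, ← C_mul]
  push_cast
  rw [show (2 * (m : ℤ) + 2 - 2) = 2 * m by ring, show (2 * (m : ℤ) + 1 + 1) = 2 * m + 2 by ring,
    show (2 * (m : ℤ) + 1 - 1) = 2 * m by ring]
  have hC : C ((1 - (q : ℝ)) / (2 * (q : ℝ) ^ (m + 1)) * (q : ℝ) ^ m) =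
      C (1 / 2 : ℝ) * C (1 / (q : ℝ)) - C (1 / 2 : ℝ) := by
    rw [← C_mul, ← C_sub]
    congr 1
    field_simp
    ring
  rw [hC]
  ring
end

section
/- Let q ≥ 2 be an integer, let n ≥ 1 be an integer, and let θ be a real or complex number with sin θ ≠ 0. Then p_n(2 cos θ) = (1/q) · ( 2 cos(nθ) + (q−1) · sin((n+1)θ) / sin θ ). -/
open Polynomial

theorem aeval_pq_two_mul_cos {q : ℕ} (hq : q ≠ 0) {θ : ℂ} (hθ : Complex.sin θ ≠ 0) (n : ℕ) :
    aeval (2 * Complex.cos θ) (pq q (n + 1))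
      = (1 / (q : ℂ)) * (2 * Complex.cos ((n + 1 : ℕ) * θ)
          + ((q : ℂ) - 1) * Complex.sin (((n + 1 : ℕ) + 1) * θ) / Complex.sin θ) := by
  have hq' : (q : ℂ) ≠ 0 := Nat.cast_ne_zero.mpr hq
  induction n using Nat.twoStepInduction with
  | zero =>
    have h : (((0 + 1 : ℕ) : ℂ) + 1) * θ = 2 * θ := by push_cast; ring
    rw [h, Complex.sin_two_mul]
    simp only [pq, aeval_X, zero_add, Nat.cast_one, one_mul]
    field_simp
    ring
  | one =>
    have h : (((1 + 1 : ℕ) : ℂ) + 1) * θ = 3 * θ := by push_cast; ring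
    rw [h, Complex.sin_three_mul]
    simp only [pq, map_sub, map_pow, aeval_X, aeval_C, Nat.reduceAdd, Nat.cast_ofNat,
      Complex.cos_two_mul, Complex.coe_algebraMap]
    push_cast
    field_simp
    linear_combination (4 * ((q : ℂ) - 1)) * Complex.sin_sq_add_cos_sq θ
  | more n ih₀ ih₁ =>
    have hcos : Complex.cos ((n + 2 + 1 : ℕ) * θ)
        = 2 * Complex.cos θ * Complex.cos ((n + 1 + 1 : ℕ) * θ)
          - Complex.cos ((n + 1 : ℕ) * θ) := by
      have h₁ : ((n + 2 + 1 : ℕ) : ℂ) * θ = (n + 1 + 1 : ℕ) * θ + θ := by push_cast; ring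
      have h₂ : ((n + 1 : ℕ) : ℂ) * θ = (n + 1 + 1 : ℕ) * θ - θ := by push_cast; ring
      rw [h₁, h₂, Complex.cos_add, Complex.cos_sub]
      ring
    have hsin : Complex.sin (((n + 2 + 1 : ℕ) + 1) * θ)
        = 2 * Complex.cos θ * Complex.sin (((n + 1 + 1 : ℕ) + 1) * θ)
          - Complex.sin (((n + 1 : ℕ) + 1) * θ) := by
      have h₁ : (((n + 2 + 1 : ℕ) : ℂ) + 1) * θ = ((n + 1 + 1 : ℕ) + 1) * θ + θ := by
        push_cast; ring
      have h₂ : (((n + 1 : ℕ) : ℂ) + 1) * θ = ((n + 1 + 1 : ℕ) + 1) * θ - θ := by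
        push_cast; ring
      rw [h₁, h₂, Complex.sin_add, Complex.sin_sub]
      ring
    have hrec : pq q (n + 2 + 1) = X * pq q (n + 1 + 1) - pq q (n + 1) := rfl
    rw [hrec, map_sub, map_mul, aeval_X, ih₀, ih₁, hcos, hsin]
    ring

theorem statement10 (q : ℕ) (hq : 2 ≤ q) (n : ℕ) (hn : 1 ≤ n) :
    (∀ θ : ℝ, Real.sin θ ≠ 0 →
      (pq q n).eval (2 * Real.cos θ)
        = (1 / (q : ℝ)) * (2 * Real.cos ((n : ℝ) * θ)
            + ((q : ℝ) - 1) * Real.sin (((n : ℝ) + 1) * θ) / Real.sin θ)) ∧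
    (∀ θ : ℂ, Complex.sin θ ≠ 0 →
      Polynomial.aeval (2 * Complex.cos θ) (pq q n)
        = (1 / (q : ℂ)) * (2 * Complex.cos ((n : ℂ) * θ)
            + ((q : ℂ) - 1) * Complex.sin (((n : ℂ) + 1) * θ) / Complex.sin θ)) := by
  have hq₀ : q ≠ 0 := by omega
  obtain ⟨m, rfl⟩ : ∃ m, n = m + 1 := ⟨n - 1, by omega⟩
  refine ⟨fun θ hθ => ?_, fun θ hθ => aeval_pq_two_mul_cos hq₀ hθ m⟩
  have hθ' : Complex.sin (θ : ℂ) ≠ 0 := by exact_mod_cast hθ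
  have h := aeval_pq_two_mul_cos hq₀ hθ' m
  have hcast : (2 * Complex.cos (θ : ℂ)) = algebraMap ℝ ℂ (2 * Real.cos θ) := by simp
  rw [hcast, aeval_algebraMap_apply, coe_aeval_eq_eval, Complex.coe_algebraMap] at h
  apply Complex.ofReal_injective
  rw [h]
  push_cast
  rfl
end

section
/- Let q ≥ 2 be an integer. Then for every integer n ≥ 0 and every real x with |x| ≤ 2, one has |p_n(x)| ≤ n + 1. -/
open Polynomial

open Polynomial.Chebyshev in
theorem abs_eval_U_real_le {y : ℝ} (hy : |y| ≤ 1) (n : ℕ) :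
    |(U ℝ n).eval y| ≤ (n : ℝ) + 1 := by
  induction n with
  | zero => simp
  | succ n ih =>
    push_cast
    rw [U_eq_X_mul_U_add_T, eval_add, eval_mul, eval_X]
    calc |y * (U ℝ n).eval y + (T ℝ (n + 1)).eval y|
        ≤ |y * (U ℝ n).eval y| + |(T ℝ (n + 1)).eval y| := abs_add_le _ _
      _ ≤ 1 * ((n : ℝ) + 1) + 1 := by
          rw [abs_mul]
          gcongr
          exact abs_eval_T_real_le_one _ hy
      _ = (n : ℝ) + 1 + 1 := by ring

open Polynomial.Chebyshev in
theorem eval_pq_succ_two_mul (q : ℕ) (y : ℝ) (n : ℕ) :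
    (pq q (n + 1)).eval (2 * y) =
      (1 - 1 / (q : ℝ)) * (U ℝ (n + 1)).eval y + 1 / (q : ℝ) * (2 * (T ℝ (n + 1)).eval y) := by
  induction n using Nat.twoStepInduction with
  | zero =>
    simp [pq]
    ring
  | one =>
    have hU := U_add_two ℝ 0
    have hT := T_add_two ℝ 0
    norm_num at hU hT
    norm_num [pq, hU, hT]
    ring
  | more n ih₁ ih₂ =>
    have hU := congrArg (eval y) (U_add_two ℝ (n + 1))
    have hT := congrArg (eval y) (T_add_two ℝ (n + 1))
    simp only [eval_sub, eval_mul, eval_X, eval_ofNat] at hU hT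
    push_cast at ih₂ ⊢
    rw [add_right_comm (n : ℤ) 2 1, hU, hT, pq, eval_sub, eval_mul, eval_X, ih₁, ih₂,
      add_right_comm (n : ℤ) 1 1]
    ring

theorem statement11 (q : ℕ) (hq : 2 ≤ q) (n : ℕ) (x : ℝ) (hx : |x| ≤ 2) :
    |(pq q n).eval x| ≤ (n : ℝ) + 1 := by
  obtain ⟨y, rfl⟩ : ∃ y, x = 2 * y := ⟨x / 2, by ring⟩
  have hy : |y| ≤ 1 := by
    rw [abs_mul, abs_two] at hx
    linarith
  cases n with
  | zero => simp [pq]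
  | succ n =>
    have hU := abs_eval_U_real_le hy (n + 1)
    have hT := Chebyshev.abs_eval_T_real_le_one (n + 1) hy
    push_cast at hU ⊢
    have hq₀ : 0 ≤ 1 / (q : ℝ) := by positivity
    have hq₁ : 0 ≤ 1 - 1 / (q : ℝ) := by
      have : (1 : ℝ) ≤ q := by exact_mod_cast (by omega : 1 ≤ q)
      rw [sub_nonneg]
      exact div_le_one_of_le₀ this (by positivity)
    rw [eval_pq_succ_two_mul]
    refine (abs_add_le _ _).trans ?_
    rw [abs_mul, abs_mul, abs_mul, abs_of_nonneg hq₀, abs_of_nonneg hq₁, abs_two]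
    have h₁ := mul_le_mul_of_nonneg_left hU hq₁
    have h₂ := mul_le_mul_of_nonneg_left hT hq₀
    have h₃ : 0 ≤ 1 / (q : ℝ) * n := by positivity
    linarith
end

section
/- Let q ≥ 2 be an integer and ε > 0. There exist constants C(ε) > 0 and c > 0, depending only on q and ε, such that for every even integer n ≥ 0 and every real λ with |λ| ≥ 2 + ε, one has p_n(λ) ≥ c · q^{C(ε)·n}. In particular, for even n, p_n is positive and grows exponentially in n at every point of the untempered region |λ| > 2. -/
open Polynomial

theorem pq_eval_neg (q : ℕ) (x : ℝ) :
    ∀ n : ℕ, (pq q n).eval (-x) = (-1) ^ n * (pq q n).eval x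
  | 0 => by simp [pq]
  | 1 => by simp [pq]
  | 2 => by simp [pq]
  | n + 3 => by
    have h1 := pq_eval_neg q x (n + 1)
    have h2 := pq_eval_neg q x (n + 2)
    simp only [pq, eval_sub, eval_mul, eval_X, h1, h2]
    ring

theorem pq_eval_abs_of_even (q : ℕ) {n : ℕ} (hn : Even n) (x : ℝ) :
    (pq q n).eval |x| = (pq q n).eval x := by
  rcases abs_choice x with h | h <;> rw [h]
  rw [pq_eval_neg, hn.neg_one_pow, one_mul]

/-- Beyond `2 + ε`, consecutive values of `pq` grow by a factor of at least `1 + ε`. -/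
theorem pq_eval_pos_and_mul_le_succ {q : ℕ} (hq : 1 ≤ q) {ε x : ℝ} (hε : 0 < ε)
    (hx : 2 + ε ≤ x) (n : ℕ) :
    0 < (pq q n).eval x ∧ (1 + ε) * (pq q n).eval x ≤ (pq q (n + 1)).eval x := by
  induction n with
  | zero => simp only [pq, eval_one, eval_X]; constructor <;> linarith
  | succ n ih =>
    obtain ⟨hpos, hle⟩ := ih
    have hpos' : 0 < (pq q (n + 1)).eval x := (mul_pos (by linarith) hpos).trans_le hle
    refine ⟨hpos', ?_⟩
    cases n with
    | zero =>
      have hq' : 1 / (q : ℝ) ≤ 1 := by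
        rw [one_div]
        exact inv_le_one_of_one_le₀ (by exact_mod_cast hq)
      simp only [pq, eval_sub, eval_pow, eval_X, eval_C]
      nlinarith
    | succ m =>
      have hrec : (pq q (m + 3)).eval x =
          x * (pq q (m + 2)).eval x - (pq q (m + 1)).eval x := by
        simp only [pq, eval_sub, eval_mul, eval_X]
      change (1 + ε) * (pq q (m + 2)).eval x ≤ (pq q (m + 3)).eval x
      change 0 < (pq q (m + 2)).eval x at hpos'
      change _ ≤ (pq q (m + 2)).eval x at hle
      rw [hrec]
      nlinarith [mul_pos hε hpos, mul_le_mul_of_nonneg_right hx hpos'.le]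

theorem one_add_pow_le_pq_eval {q : ℕ} (hq : 1 ≤ q) {ε x : ℝ} (hε : 0 < ε)
    (hx : 2 + ε ≤ x) (n : ℕ) : (1 + ε) ^ n ≤ (pq q n).eval x := by
  induction n with
  | zero => simp [pq]
  | succ n ih =>
    rw [pow_succ']
    exact (mul_le_mul_of_nonneg_left ih (by linarith)).trans
      (pq_eval_pos_and_mul_le_succ hq hε hx n).2

theorem statement12 (q : ℕ) (hq : 2 ≤ q) (ε : ℝ) (hε : 0 < ε) :
    ∃ Cε c : ℝ, 0 < Cε ∧ 0 < c ∧
      ∀ n : ℕ, Even n → ∀ lam : ℝ, 2 + ε ≤ |lam| →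
        c * (q : ℝ) ^ (Cε * (n : ℝ)) ≤ (pq q n).eval lam := by
  have hq1 : (1 : ℝ) < q := by exact_mod_cast hq
  refine ⟨Real.logb q (1 + ε), 1, Real.logb_pos hq1 (by linarith), one_pos, ?_⟩
  intro n hn lam hlam
  rw [one_mul, Real.rpow_mul (by linarith), Real.rpow_logb (by linarith) hq1.ne' (by linarith),
    Real.rpow_natCast, ← pq_eval_abs_of_even q hn]
  exact one_add_pow_le_pq_eval (by omega) hε hlam n
end

section
/- For every p > 8 there exists a constant C_p such that for every integer s ≥ 1 and every spherical harmonic ψ of degree s on S², one has ‖ψ‖_{L^p(S²,σ)} ≤ C_p · s^{1/2 − 2/p} · ‖ψ‖_{L²(S²,σ)}. -/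
open MeasureTheory

/-- The surface measure `σ` on the unit sphere `S² ⊆ ℝ³`. -/
noncomputable def sphereMeasure :
    Measure (Metric.sphere (0 : EuclideanSpace ℝ (Fin 3)) 1) :=
  (volume : Measure (EuclideanSpace ℝ (Fin 3))).toSphere

/-- `ψ : ℝ³ → ℝ` is a homogeneous harmonic polynomial of degree `s`; its restriction to the
unit sphere is a spherical harmonic of degree `s`. -/
def IsSphericalHarmonic (s : ℕ) (ψ : EuclideanSpace ℝ (Fin 3) → ℝ) : Prop :=
  ∃ P : MvPolynomial (Fin 3) ℝ, P.IsHomogeneous s ∧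
    (∑ i : Fin 3, MvPolynomial.pderiv i (MvPolynomial.pderiv i P)) = 0 ∧
    ∀ x : EuclideanSpace ℝ (Fin 3), ψ x = MvPolynomial.eval (fun i => x i) P

/-- The `L^p(S², σ)` norm of a function on the unit sphere. -/
noncomputable def sphLp (p : ℝ)
    (f : Metric.sphere (0 : EuclideanSpace ℝ (Fin 3)) 1 → ℝ) : ℝ :=
  (∫ x, |f x| ^ p ∂sphereMeasure) ^ (1 / p)

section Legendre

open Polynomial

/-- The Legendre polynomials, normalised by `P_n(1) = 1`. -/
noncomputable def legendreP : ℕ → ℝ[X]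
  | 0 => 1
  | 1 => X
  | n + 2 => C ((2 * n + 3 : ℝ) / (n + 2)) * (X * legendreP (n + 1))
      - C ((n + 1 : ℝ) / (n + 2)) * legendreP n

lemma legendreP_recurrence (n : ℕ) (t : ℝ) :
    (n + 2 : ℝ) * (legendreP (n + 2)).eval t =
      (2 * n + 3) * (t * (legendreP (n + 1)).eval t) - (n + 1) * (legendreP n).eval t := by
  have h : (n + 2 : ℝ) ≠ 0 := by positivity
  simp only [legendreP, eval_sub, eval_mul, eval_C, eval_X]
  field_simp

lemma legendreP_deriv_recurrence (n : ℕ) (t : ℝ) :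
    (n + 2 : ℝ) * (legendreP (n + 2)).derivative.eval t =
      (2 * n + 3) * ((legendreP (n + 1)).eval t + t * (legendreP (n + 1)).derivative.eval t)
        - (n + 1) * (legendreP n).derivative.eval t := by
  have h : (n + 2 : ℝ) ≠ 0 := by positivity
  simp only [legendreP, derivative_sub, derivative_mul, derivative_C, derivative_X, eval_sub,
    eval_add, eval_mul, eval_C, eval_X, eval_zero, eval_one]
  field_simp
  ring

lemma legendreP_deriv_relations (n : ℕ) (t : ℝ) :
    (legendreP (n + 1)).derivative.eval t =
        t * (legendreP n).derivative.eval t + (n + 1) * (legendreP n).eval t ∧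
      t * (legendreP (n + 1)).derivative.eval t - (legendreP n).derivative.eval t =
        (n + 1) * (legendreP (n + 1)).eval t := by
  induction n with
  | zero => simp [legendreP]
  | succ n ih =>
    obtain ⟨ha, hc⟩ := ih
    have h : (n + 2 : ℝ) ≠ 0 := by positivity
    have hr := legendreP_recurrence n t
    have hd := legendreP_deriv_recurrence n t
    push_cast
    have key : (legendreP (n + 2)).derivative.eval t =
        t * (legendreP (n + 1)).derivative.eval t + (n + 2) * (legendreP (n + 1)).eval t := by
      apply mul_left_cancel₀ h
      linear_combination hd + (n + 1 : ℝ) * hc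
    refine ⟨by linear_combination key, ?_⟩
    linear_combination t * key - hr - ha + t * hc

lemma one_sub_sq_mul_deriv_legendreP (n : ℕ) (t : ℝ) :
    (1 - t ^ 2) * (legendreP (n + 1)).derivative.eval t =
      (n + 1) * ((legendreP n).eval t - t * (legendreP (n + 1)).eval t) := by
  obtain ⟨ha, hc⟩ := legendreP_deriv_relations n t
  linear_combination ha - t * hc

/-- The Legendre differential equation. -/
lemma legendreP_ode (n : ℕ) (t : ℝ) :
    (1 - t ^ 2) * (legendreP n).derivative.derivative.eval t
      - 2 * t * (legendreP n).derivative.eval t + n * (n + 1) * (legendreP n).eval t = 0 := by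
  cases n with
  | zero => simp [legendreP]
  | succ n =>
    have h : (1 - X ^ 2) * (legendreP (n + 1)).derivative =
        C (n + 1 : ℝ) * (legendreP n - X * legendreP (n + 1)) :=
      Polynomial.funext fun t => by simpa using one_sub_sq_mul_deriv_legendreP n t
    have h' := congrArg (fun p => p.derivative.eval t) h
    simp only [derivative_mul, derivative_sub, derivative_C, derivative_X, derivative_one,
      derivative_X_pow, eval_sub, eval_add, eval_mul, eval_C, eval_X, eval_zero, eval_one,
      eval_pow] at h'
    obtain ⟨-, hc⟩ := legendreP_deriv_relations n t
    push_cast at h' ⊢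
    norm_num at h'
    linear_combination h' - (n + 1 : ℝ) * hc

lemma legendreP_eval_one (n : ℕ) : (legendreP n).eval 1 = 1 := by
  induction n using Nat.twoStepInduction with
  | zero => simp [legendreP]
  | one => simp [legendreP]
  | more n h0 h1 =>
    have h : (n + 2 : ℝ) ≠ 0 := by positivity
    apply mul_left_cancel₀ h
    rw [legendreP_recurrence, h0, h1]
    ring

lemma legendreP_eval_neg (n : ℕ) (t : ℝ) :
    (legendreP n).eval (-t) = (-1) ^ n * (legendreP n).eval t := by
  induction n using Nat.twoStepInduction with
  | zero => simp [legendreP]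
  | one => simp [legendreP]
  | more n h0 h1 =>
    have h : (n + 2 : ℝ) ≠ 0 := by positivity
    apply mul_left_cancel₀ h
    rw [legendreP_recurrence, h0, h1]
    linear_combination -(-1 : ℝ) ^ n * legendreP_recurrence n t

lemma legendreP_eval_abs_sq (n : ℕ) (t : ℝ) :
    (legendreP n).eval |t| ^ 2 = (legendreP n).eval t ^ 2 := by
  rcases abs_cases t with ⟨h, -⟩ | ⟨h, -⟩
  · rw [h]
  · rw [h, legendreP_eval_neg, mul_pow, ← pow_mul, mul_comm n, pow_mul]
    norm_num

lemma legendreP_eval_zero_sq_le (n : ℕ) : (legendreP n).eval 0 ^ 2 ≤ 1 / (n + 1) := by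
  induction n using Nat.twoStepInduction with
  | zero => simp [legendreP]
  | one => simp [legendreP]
  | more n h0 h1 =>
    have h : (n + 2 : ℝ) ≠ 0 := by positivity
    have hr : (legendreP (n + 2)).eval 0 = -((n + 1) / (n + 2)) * (legendreP n).eval 0 := by
      apply mul_left_cancel₀ h
      rw [legendreP_recurrence]
      field_simp
      ring
    rw [hr, mul_pow]
    calc _ ≤ (-((n + 1 : ℝ) / (n + 2))) ^ 2 * (1 / (n + 1)) := by gcongr
      _ ≤ _ := by
        push_cast
        rw [neg_sq, div_pow, div_mul_div_comm, div_le_div_iff₀ (by positivity) (by positivity)]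
        have : (0 : ℝ) ≤ n := n.cast_nonneg
        nlinarith [mul_nonneg this this, mul_nonneg this (mul_nonneg this this)]

lemma legendreP_deriv_eval_zero_sq_le (n : ℕ) : (legendreP n).derivative.eval 0 ^ 2 ≤ n := by
  cases n with
  | zero => simp [legendreP]
  | succ n =>
    rw [(legendreP_deriv_relations n 0).1, zero_mul, zero_add, mul_pow]
    have h := legendreP_eval_zero_sq_le n
    rw [le_div_iff₀ (by positivity)] at h
    push_cast
    nlinarith [n.cast_nonneg (α := ℝ)]

lemma legendreP_sq_le_one_of_nonneg {n : ℕ} (hn : 1 ≤ n) {t : ℝ} (h0 : 0 ≤ t) (h1 : t ≤ 1) :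
    (legendreP n).eval t ^ 2 ≤ 1 := by
  have hn' : (1 : ℝ) ≤ n := by exact_mod_cast hn
  set W : ℝ → ℝ := fun x => n * (n + 1) * (legendreP n).eval x ^ 2 +
    (1 - x ^ 2) * (legendreP n).derivative.eval x ^ 2 with hW
  have hd (x : ℝ) : HasDerivAt W (2 * x * (legendreP n).derivative.eval x ^ 2) x := by
    have hP := (legendreP n).hasDerivAt x
    have hP' := (legendreP n).derivative.hasDerivAt x
    convert! ((hP.pow 2).const_mul (n * (n + 1) : ℝ)).add
      ((((hasDerivAt_id x).pow 2).const_sub 1).mul (hP'.pow 2)) using 1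
    simp
    linear_combination (-2 * (legendreP n).derivative.eval x) * legendreP_ode n x
  have hmono : MonotoneOn W (Set.Icc 0 1) := by
    refine monotoneOn_of_deriv_nonneg (convex_Icc 0 1)
      (fun x _ => (hd x).continuousAt.continuousWithinAt)
      (fun x _ => (hd x).differentiableAt.differentiableWithinAt) fun x hx => ?_
    rw [interior_Icc] at hx
    rw [(hd x).deriv]
    have := hx.1
    positivity
  have h := hmono ⟨h0, h1⟩ (Set.right_mem_Icc.2 zero_le_one) h1
  simp only [hW, legendreP_eval_one] at h
  have h2 : 0 ≤ (1 - t ^ 2) * (legendreP n).derivative.eval t ^ 2 :=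
    mul_nonneg (by nlinarith) (sq_nonneg _)
  have h3 : (0 : ℝ) < n * (n + 1) := by positivity
  refine le_of_mul_le_mul_left ?_ h3
  linarith

/-- Bernstein's inequality, obtained from the monotonicity of the Sonin function. -/
lemma sqrt_mul_legendreP_sq_le_of_nonneg {n : ℕ} (hn : 1 ≤ n) {t : ℝ} (h0 : 0 ≤ t)
    (h1 : t < 1) : √(1 - t ^ 2) * (legendreP n).eval t ^ 2 ≤ 2 / n := by
  have hn' : (1 : ℝ) ≤ n := by exact_mod_cast hn
  set D : ℝ → ℝ := fun x => (2 * n + 1) ^ 2 * (1 - x ^ 2) + 1 with hD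
  set Q : ℝ → ℝ := fun x => 2 * ((1 - x ^ 2) * (legendreP n).derivative.eval x)
    - x * (legendreP n).eval x with hQ
  set W : ℝ → ℝ := fun x => √(1 - x ^ 2) * ((legendreP n).eval x ^ 2 + Q x ^ 2 / D x) with hW
  have hpos {x : ℝ} (hx : x ∈ Set.Ico (0 : ℝ) 1) : 0 < 1 - x ^ 2 := by
    nlinarith [hx.1, hx.2]
  have hDpos {x : ℝ} (hx : x ∈ Set.Ico (0 : ℝ) 1) : 0 < D x := by
    have := hpos hx
    positivity
  have hd {x : ℝ} (hx : x ∈ Set.Ico (0 : ℝ) 1) :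
      HasDerivAt W (-(2 * x * Q x ^ 2) / (√(1 - x ^ 2) * D x ^ 2)) x := by
    have hw := hpos hx
    have hP := (legendreP n).hasDerivAt x
    have hP' := (legendreP n).derivative.hasDerivAt x
    have hone : HasDerivAt (fun x : ℝ => 1 - x ^ 2) (-(2 * x)) x := by
      simpa using ((hasDerivAt_id x).pow 2).const_sub 1
    have hDd : HasDerivAt D ((2 * n + 1) ^ 2 * (-(2 * x))) x :=
      (hone.const_mul ((2 * n + 1 : ℝ) ^ 2)).add_const 1
    have hQd : HasDerivAt Q (-(x * (legendreP n).derivative.eval x)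
        - (2 * n * (n + 1) + 1) * (legendreP n).eval x) x := by
      convert! ((hone.mul hP').const_mul 2).sub ((hasDerivAt_id x).mul hP) using 1
      simp
      linear_combination (-2 : ℝ) * legendreP_ode n x
    convert! (hone.sqrt hw.ne').mul ((hP.pow 2).add ((hQd.pow 2).div hDd (hDpos hx).ne')) using 1
    have hs : 0 < √(1 - x ^ 2) := Real.sqrt_pos.2 hw
    have hs2 : √(1 - x ^ 2) ^ 2 = 1 - x ^ 2 := Real.sq_sqrt hw.le
    have hDx := (hDpos hx).ne'
    simp only [Pi.add_apply, Pi.pow_apply, Pi.div_apply]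
    field_simp
    rw [hs2]
    simp only [hQ, hD]
    ring
  have hanti : AntitoneOn W (Set.Ico 0 1) := by
    refine antitoneOn_of_deriv_nonpos (convex_Ico 0 1)
      (fun x hx => (hd hx).continuousAt.continuousWithinAt)
      (fun x hx => (hd (interior_subset hx)).differentiableAt.differentiableWithinAt)
      fun x hx => ?_
    have hx' := interior_subset hx
    rw [(hd hx').deriv]
    have := hx'.1
    exact div_nonpos_of_nonpos_of_nonneg (by simp; positivity) (by positivity)
  have h := hanti (Set.left_mem_Ico.2 one_pos) ⟨h0, h1⟩ h0
  have hle : √(1 - t ^ 2) * (legendreP n).eval t ^ 2 ≤ W t := by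
    have := (hDpos ⟨h0, h1⟩).le
    refine mul_le_mul_of_nonneg_left ?_ (Real.sqrt_nonneg _)
    exact le_add_of_nonneg_right (by positivity)
  refine hle.trans (h.trans ?_)
  have hz := legendreP_eval_zero_sq_le n
  have hz' := legendreP_deriv_eval_zero_sq_le n
  have e1 : (legendreP n).eval 0 ^ 2 ≤ 1 / n :=
    hz.trans (one_div_le_one_div_of_le (by positivity) (by linarith))
  have e2 : 4 * (legendreP n).derivative.eval 0 ^ 2 / ((2 * n + 1) ^ 2 + 1) ≤ 1 / (n : ℝ) := by
    rw [div_le_div_iff₀ (by positivity) (by positivity)]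
    nlinarith
  calc W 0 = (legendreP n).eval 0 ^ 2 +
        4 * (legendreP n).derivative.eval 0 ^ 2 / ((2 * n + 1) ^ 2 + 1) := by
        simp [hW, hQ, hD]
        ring
    _ ≤ 1 / n + 1 / n := add_le_add e1 e2
    _ = 2 / n := by ring

lemma legendreP_sq_mul_le {n : ℕ} (hn : 1 ≤ n) {t : ℝ} (ht : |t| ≤ 1) :
    (legendreP n).eval t ^ 2 * (1 + n * √(1 - t ^ 2)) ≤ 3 := by
  have hn' : (0 : ℝ) < n := by exact_mod_cast hn
  rw [← legendreP_eval_abs_sq, ← sq_abs t]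
  have h1 := legendreP_sq_le_one_of_nonneg hn (abs_nonneg t) ht
  have h2 : √(1 - |t| ^ 2) * (legendreP n).eval |t| ^ 2 ≤ 2 / n := by
    rcases ht.lt_or_eq with h | h
    · exact sqrt_mul_legendreP_sq_le_of_nonneg hn (abs_nonneg t) h
    · rw [h]
      simp
      positivity
  rw [le_div_iff₀ hn'] at h2
  linarith
end Legendre

section ZonalHarmonics

open MvPolynomial

/-- The linear form `y ↦ ⟪x, y⟫` as a polynomial. -/
noncomputable def linForm (x : Fin 3 → ℝ) : MvPolynomial (Fin 3) ℝ := ∑ i, C (x i) * X i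

/-- The solid zonal harmonic `|y| ^ n * P_n (⟪x, y⟫ / |y|)` of degree `n` with pole `x`. -/
noncomputable def zonal (x : Fin 3 → ℝ) : ℕ → MvPolynomial (Fin 3) ℝ
  | 0 => 1
  | 1 => linForm x
  | n + 2 => C ((2 * n + 3 : ℝ) / (n + 2)) * (linForm x * zonal x (n + 1))
      - C ((n + 1 : ℝ) / (n + 2)) * ((∑ i, X i ^ 2) * zonal x n)

lemma zonal_recurrence (x : Fin 3 → ℝ) (n : ℕ) :
    C (n + 1 : ℝ) * zonal x (n + 1) =
      C (2 * n + 1 : ℝ) * (linForm x * zonal x n)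
        - C (n : ℝ) * ((∑ i, X i ^ 2) * zonal x (n - 1)) := by
  cases n with
  | zero => simp [zonal]
  | succ n =>
    have h : (n + 2 : ℝ) ≠ 0 := by positivity
    simp only [zonal, mul_sub, ← mul_assoc, ← C_mul, Nat.add_sub_cancel]
    push_cast
    congr 4 <;> · field_simp; ring

lemma isHomogeneous_linForm (x : Fin 3 → ℝ) : (linForm x).IsHomogeneous 1 :=
  IsHomogeneous.sum _ _ _ fun i _ => by
    simpa using (isHomogeneous_C (Fin 3) (x i)).mul (isHomogeneous_X ℝ i)

lemma isHomogeneous_zonal (x : Fin 3 → ℝ) (n : ℕ) : (zonal x n).IsHomogeneous n := by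
  induction n using Nat.twoStepInduction with
  | zero => exact isHomogeneous_one _ _
  | one => exact isHomogeneous_linForm x
  | more n h0 h1 =>
    refine IsHomogeneous.sub ?_ ?_
    · have := (isHomogeneous_C (Fin 3) ((2 * n + 3 : ℝ) / (n + 2))).mul
        ((isHomogeneous_linForm x).mul h1)
      convert! this using 1
      ring
    · have hq : (∑ i : Fin 3, (X i : MvPolynomial (Fin 3) ℝ) ^ 2).IsHomogeneous 2 :=
        IsHomogeneous.sum _ _ _ fun i _ => by simpa using (isHomogeneous_X ℝ i).pow 2
      have := (isHomogeneous_C (Fin 3) ((n + 1 : ℝ) / (n + 2))).mul (hq.mul h0)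
      convert! this using 1
      ring

/-- The derivative in the direction `x`. -/
noncomputable def dirDeriv (x : Fin 3 → ℝ) :
    Derivation ℝ (MvPolynomial (Fin 3) ℝ) (MvPolynomial (Fin 3) ℝ) := ∑ i, x i • pderiv i

lemma dirDeriv_apply (x : Fin 3 → ℝ) (F : MvPolynomial (Fin 3) ℝ) :
    dirDeriv x F = ∑ i, C (x i) * pderiv i F := by
  simp [dirDeriv, Fin.sum_univ_three, smul_eq_C_mul]

lemma dirDeriv_mul (x : Fin 3 → ℝ) (F G : MvPolynomial (Fin 3) ℝ) :
    dirDeriv x (F * G) = dirDeriv x F * G + F * dirDeriv x G := by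
  simp
  ring

lemma dirDeriv_C_mul (x : Fin 3 → ℝ) (a : ℝ) (F : MvPolynomial (Fin 3) ℝ) :
    dirDeriv x (C a * F) = C a * dirDeriv x F := by
  rw [← smul_eq_C_mul, Derivation.map_smul, smul_eq_C_mul]

lemma dirDeriv_linForm {x : Fin 3 → ℝ} (hx : ∑ i, x i ^ 2 = 1) :
    dirDeriv x (linForm x) = 1 := by
  have hx' : C (x 0) ^ 2 + C (x 1) ^ 2 + C (x 2) ^ 2 = (1 : MvPolynomial (Fin 3) ℝ) := by
    rw [← C_pow, ← C_pow, ← C_pow, ← C_add, ← C_add, ← Fin.sum_univ_three (fun i => x i ^ 2), hx,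
      C_1]
  simp [dirDeriv_apply, linForm, Fin.sum_univ_three, pderiv_X, Pi.single_apply]
  linear_combination hx'

lemma dirDeriv_sum_X_sq (x : Fin 3 → ℝ) :
    dirDeriv x (∑ i, X i ^ 2) = 2 * linForm x := by
  simp [dirDeriv_apply, linForm, Fin.sum_univ_three, pderiv_X, Pi.single_apply]
  ring

lemma dirDeriv_zonal {x : Fin 3 → ℝ} (hx : ∑ i, x i ^ 2 = 1) (n : ℕ) :
    dirDeriv x (zonal x n) = C (n : ℝ) * zonal x (n - 1) := by
  induction n using Nat.strong_induction_on with
  | _ n ih =>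
  rcases n with _ | _ | n
  · simp [zonal]
  · simp [zonal, dirDeriv_linForm hx]
  have hne : (C (n + 2 : ℝ) : MvPolynomial (Fin 3) ℝ) ≠ 0 := by
    rw [Ne, C_eq_zero]
    positivity
  apply mul_left_cancel₀ hne
  have h := congrArg (dirDeriv x) (zonal_recurrence x (n + 1))
  have h' := zonal_recurrence x n
  simp only [map_sub, dirDeriv_C_mul] at h
  simp only [dirDeriv_mul, dirDeriv_linForm hx, dirDeriv_sum_X_sq,
    Nat.add_sub_cancel, ih (n + 1) (by omega), ih n (by omega)] at h
  push_cast at h h' ⊢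
  simp only [map_add, map_mul, map_one, map_ofNat] at h h' ⊢
  linear_combination h - (C (n : ℝ) + 1) * h'

/-- The Laplacian on polynomials. -/
noncomputable def laplacian (F : MvPolynomial (Fin 3) ℝ) : MvPolynomial (Fin 3) ℝ :=
  ∑ i, pderiv i (pderiv i F)

lemma laplacian_sub (F G : MvPolynomial (Fin 3) ℝ) :
    laplacian (F - G) = laplacian F - laplacian G := by
  simp [laplacian]

lemma laplacian_C_mul (a : ℝ) (F : MvPolynomial (Fin 3) ℝ) :
    laplacian (C a * F) = C a * laplacian F := by
  simp [laplacian, Finset.mul_sum]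

lemma laplacian_pderiv (i : Fin 3) (F : MvPolynomial (Fin 3) ℝ) :
    laplacian (pderiv i F) = pderiv i (laplacian F) := by
  have comm (j : Fin 3) (G : MvPolynomial (Fin 3) ℝ) :
      pderiv j (pderiv i G) = pderiv i (pderiv j G) := by
    have h : ⁅pderiv j, pderiv i⁆ = (0 : Derivation ℝ (MvPolynomial (Fin 3) ℝ) _) :=
      derivation_ext fun k => by
        rw [Derivation.commutator_apply, pderiv_X, pderiv_X, Pi.single_apply, Pi.single_apply]
        split_ifs <;> simp
    simpa [Derivation.commutator_apply, sub_eq_zero] using DFunLike.congr_fun h G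
  simp only [laplacian, map_sum, comm]

lemma laplacian_dirDeriv (x : Fin 3 → ℝ) (F : MvPolynomial (Fin 3) ℝ) :
    laplacian (dirDeriv x F) = dirDeriv x (laplacian F) := by
  have hadd (G H : MvPolynomial (Fin 3) ℝ) :
      laplacian (G + H) = laplacian G + laplacian H := by
    simp [laplacian, Finset.sum_add_distrib]
  simp only [dirDeriv_apply, Fin.sum_univ_three, hadd, laplacian_C_mul, laplacian_pderiv]

lemma laplacian_linForm_mul (x : Fin 3 → ℝ) (F : MvPolynomial (Fin 3) ℝ) :
    laplacian (linForm x * F) = 2 * dirDeriv x F + linForm x * laplacian F := by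
  simp [laplacian, linForm, dirDeriv_apply, Fin.sum_univ_three, pderiv_X, Pi.single_apply]
  ring

lemma laplacian_sum_X_sq_mul {n : ℕ} {F : MvPolynomial (Fin 3) ℝ} (hF : F.IsHomogeneous n) :
    laplacian ((∑ i, X i ^ 2) * F) =
      C (4 * n + 6 : ℝ) * F + (∑ i, X i ^ 2) * laplacian F := by
  have h := hF.sum_X_mul_pderiv
  simp only [laplacian, Fin.sum_univ_three, nsmul_eq_mul, pderiv_mul, map_add, pderiv_pow,
    pderiv_X, Pi.single_apply] at h ⊢
  have h2 (i : Fin 3) : pderiv i (2 : MvPolynomial (Fin 3) ℝ) = 0 := (pderiv i).map_natCast 2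
  simp [h2]
  simp only [map_ofNat]
  linear_combination 4 * h

lemma laplacian_zonal {x : Fin 3 → ℝ} (hx : ∑ i, x i ^ 2 = 1) (n : ℕ) :
    laplacian (zonal x n) = 0 := by
  induction n using Nat.twoStepInduction with
  | zero => simp [zonal, laplacian]
  | one => simp [zonal, laplacian, linForm, Fin.sum_univ_three, pderiv_X, Pi.single_apply]
  | more n h0 h1 =>
    have hne : (C (n + 2 : ℝ) : MvPolynomial (Fin 3) ℝ) ≠ 0 := by
      rw [Ne, C_eq_zero]
      positivity
    apply mul_left_cancel₀ hne
    have h := congrArg laplacian (zonal_recurrence x (n + 1))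
    rw [laplacian_sub, laplacian_C_mul, laplacian_C_mul, laplacian_C_mul, laplacian_linForm_mul,
      Nat.add_sub_cancel, laplacian_sum_X_sq_mul (isHomogeneous_zonal x n), dirDeriv_zonal hx, h0,
      h1] at h
    push_cast at h ⊢
    simp only [map_add, map_mul, map_one, map_ofNat] at h ⊢
    linear_combination h

lemma eval_zonal {x y : Fin 3 → ℝ} (hy : ∑ i, y i ^ 2 = 1) (n : ℕ) :
    eval y (zonal x n) = (legendreP n).eval (∑ i, x i * y i) := by
  induction n using Nat.twoStepInduction with
  | zero => simp [zonal, legendreP]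
  | one => simp [zonal, legendreP, linForm]
  | more n h0 h1 => simp [zonal, legendreP, linForm, h0, h1, hy]

variable {L : MvPolynomial (Fin 3) ℝ →ₗ[ℝ] ℝ}

/-- A functional satisfying the Gaussian integration by parts formula makes harmonic polynomials
orthogonal to polynomials of lower degree. -/
lemma map_mul_eq_zero_of_laplacian_eq_zero (hL : ∀ i F, L (X i * F) = L (pderiv i F)) {m : ℕ} :
    ∀ {n : ℕ} {F G : MvPolynomial (Fin 3) ℝ}, F.IsHomogeneous m → G.IsHomogeneous n →
      laplacian G = 0 → m < n → L (F * G) = 0 := by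
  induction m with
  | zero =>
    intro n F G hF hG hΔ hmn
    rw [← totalDegree_zero_iff_isHomogeneous, totalDegree_eq_zero_iff_eq_C] at hF
    have h := congrArg L hG.sum_X_mul_pderiv
    have hΔ' := congrArg L hΔ
    simp only [laplacian, map_sum, hL, map_zero] at h hΔ'
    rw [hΔ', map_nsmul, eq_comm, smul_eq_zero] at h
    rw [hF, ← smul_eq_C_mul, map_smul, h.resolve_left (by omega), smul_zero]
  | succ m ih =>
    intro n F G hF hG hΔ hmn
    have h := congrArg (fun P => L (F * P)) hG.sum_X_mul_pderiv
    have hΔ' := congrArg (fun P => L (F * P)) hΔ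
    have h2 (i : Fin 3) : L (F * (X i * pderiv i G)) = L (F * pderiv i (pderiv i G)) := by
      rw [mul_left_comm, hL, pderiv_mul, map_add, ih (hF.pderiv (i := i)) (hG.pderiv (i := i)),
        zero_add]
      · rw [laplacian_pderiv, hΔ, map_zero]
      · omega
    simp only [laplacian, Finset.mul_sum, map_sum, mul_zero, map_zero, h2] at h hΔ'
    rw [hΔ', nsmul_eq_mul, mul_left_comm, ← nsmul_eq_mul, map_nsmul, eq_comm, smul_eq_zero] at h
    exact h.resolve_left (by omega)

lemma map_sum_X_sq_mul_mul (hL : ∀ i F, L (X i * F) = L (pderiv i F)) {m n : ℕ}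
    {F G : MvPolynomial (Fin 3) ℝ} (hF : F.IsHomogeneous m) (hG : G.IsHomogeneous n) :
    L ((∑ i, X i ^ 2) * F * G) = (m + n + 3) * L (F * G) := by
  have h := congrArg L (hF.mul hG).sum_X_mul_pderiv
  have h2 (i : Fin 3) : L (X i ^ 2 * (F * G)) = L (F * G) + L (X i * pderiv i (F * G)) := by
    rw [pow_two, mul_assoc, hL, pderiv_mul, pderiv_X_self, one_mul, map_add]
  rw [mul_assoc, Finset.sum_mul, map_sum]
  simp only [h2, Fin.sum_univ_three, map_add, map_nsmul] at h ⊢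
  rw [nsmul_eq_mul] at h
  push_cast at h
  linear_combination h

/-- The reproducing property of zonal harmonics. -/
lemma map_zonal_mul (hL : ∀ i F, L (X i * F) = L (pderiv i F)) {x : Fin 3 → ℝ}
    (hx : ∑ i, x i ^ 2 = 1) (n : ℕ) :
    ∀ {F : MvPolynomial (Fin 3) ℝ}, F.IsHomogeneous n → laplacian F = 0 →
      L (zonal x n * F) = (∏ k ∈ Finset.range n, (2 * k + 1 : ℝ)) * L 1 * eval x F := by
  induction n with
  | zero =>
    intro F hF _
    rw [← totalDegree_zero_iff_isHomogeneous, totalDegree_eq_zero_iff_eq_C] at hF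
    rw [hF, zonal, one_mul, ← mul_one (C _), ← smul_eq_C_mul, map_smul]
    simp [mul_comm]
  | succ n ih =>
    intro F hF hΔ
    have hD : (dirDeriv x F).IsHomogeneous n := by
      rw [dirDeriv_apply]
      exact IsHomogeneous.sum _ _ _ fun i _ => (hF.pderiv (i := i)).C_mul _
    have hΔD : laplacian (dirDeriv x F) = 0 := by
      rw [laplacian_dirDeriv, hΔ, map_zero]
    have hlin (P : MvPolynomial (Fin 3) ℝ) : L (linForm x * P) = L (dirDeriv x P) := by
      simp [linForm, dirDeriv_apply, Finset.sum_mul, ← smul_eq_C_mul, hL]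
    have heuler : eval x (dirDeriv x F) = (n + 1) * eval x F := by
      have := congrArg (eval x) hF.sum_X_mul_pderiv
      simpa [dirDeriv_apply] using this
    have hq : (n : ℝ) * L ((∑ i, X i ^ 2) * zonal x (n - 1) * F) = 0 := by
      rcases n with _ | n
      · simp
      · rw [map_sum_X_sq_mul_mul hL (isHomogeneous_zonal x _) hF,
          map_mul_eq_zero_of_laplacian_eq_zero hL (isHomogeneous_zonal x _) hF hΔ (by omega)]
        simp
    have h1 : L (zonal x (n - 1) * F) = 0 :=
      map_mul_eq_zero_of_laplacian_eq_zero hL (isHomogeneous_zonal x _) hF hΔ (by omega)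
    have hℓ : L (linForm x * zonal x n * F) = L (zonal x n * dirDeriv x F) := by
      rw [mul_assoc, hlin, dirDeriv_mul, map_add, dirDeriv_zonal hx, mul_assoc, ← smul_eq_C_mul,
        map_smul, h1, smul_zero, zero_add]
    have h := congrArg (fun P => L (P * F)) (zonal_recurrence x n)
    simp only [← smul_eq_C_mul, sub_mul, smul_mul_assoc] at h
    rw [map_sub, map_smul, map_smul, map_smul, smul_eq_mul, smul_eq_mul, smul_eq_mul, hq, hℓ,
      ih hD hΔD, heuler] at h
    rw [Finset.prod_range_succ]
    have hne : (n + 1 : ℝ) ≠ 0 := by positivity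
    apply mul_left_cancel₀ hne
    linear_combination h

end ZonalHarmonics
section PolarCoordinates

open Set

instance : IsFiniteMeasure sphereMeasure := by
  unfold sphereMeasure; infer_instance

lemma sphereMeasure_real_univ_pos : 0 < sphereMeasure.real univ := by
  have : NeZero sphereMeasure := ⟨Measure.toSphere_ne_zero _⟩
  exact measureReal_univ_pos

/-- Integration in polar coordinates of a positively homogeneous function times a radial one. -/
lemma integral_homogeneous_mul_fun_norm {F : EuclideanSpace ℝ (Fin 3) → ℝ} {d : ℕ}
    (hF : ∀ r : ℝ, 0 < r → ∀ y, ‖y‖ = 1 → F (r • y) = r ^ d * F y) (g : ℝ → ℝ) :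
    ∫ y, F y * g ‖y‖ = (∫ ω, F ω ∂sphereMeasure) * ∫ r in Ioi (0 : ℝ), r ^ (d + 2) * g r := by
  set μ := (volume : Measure (EuclideanSpace ℝ (Fin 3)))
  calc
    ∫ y, F y * g ‖y‖ = ∫ y : ({(0)}ᶜ : Set (EuclideanSpace ℝ (Fin 3))), F y.1 * g ‖y.1‖
        ∂(μ.comap (↑)) := by
      rw [integral_subtype_comap (measurableSet_singleton _).compl fun y ↦ F y * g ‖y‖,
        restrict_compl_singleton]
    _ = ∫ z, F z.1 * (z.2.1 ^ d * g z.2) ∂μ.toSphere.prod (.volumeIoiPow 2) := by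
      have h := μ.measurePreserving_homeomorphUnitSphereProd.integral_comp
        (Homeomorph.measurableEmbedding _)
        (fun z : Metric.sphere (0 : EuclideanSpace ℝ (Fin 3)) 1 × Ioi (0 : ℝ) ↦
          F z.1 * (z.2.1 ^ d * g z.2))
      rw [show Module.finrank ℝ (EuclideanSpace ℝ (Fin 3)) - 1 = 2 by simp] at h
      rw [← h]
      refine integral_congr_ae (.of_forall fun y ↦ ?_)
      have hy : 0 < ‖y.1‖ := norm_pos_iff.2 y.2
      have := hF ‖y.1‖ hy (‖y.1‖⁻¹ • y.1) (by
        rw [norm_smul, norm_inv, norm_norm, inv_mul_cancel₀ hy.ne'])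
      rw [smul_inv_smul₀ hy.ne'] at this
      simp [this]
      ring
    _ = (∫ ω, F ω ∂sphereMeasure) *
          ∫ r : Ioi (0 : ℝ), r.1 ^ d * g r ∂.volumeIoiPow 2 :=
      integral_prod_mul (fun ω : Metric.sphere (0 : EuclideanSpace ℝ (Fin 3)) 1 ↦ F ω)
        (fun r : Ioi (0 : ℝ) ↦ r.1 ^ d * g r)
    _ = _ := by
      congr 1
      simp only [Measure.volumeIoiPow, ENNReal.ofReal]
      rw [integral_withDensity_eq_integral_smul,
        integral_subtype_comap measurableSet_Ioi fun a ↦ Real.toNNReal (a ^ 2) • (a ^ d * g a),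
        setIntegral_congr_fun measurableSet_Ioi fun x hx ↦ ?_]
      · simp only [NNReal.smul_def, smul_eq_mul]
        rw [Real.coe_toNNReal _ (pow_nonneg (le_of_lt hx) _)]
        ring
      · exact (measurable_subtype_coe.pow_const _).real_toNNReal

end PolarCoordinates
section GaussianFunctional

open MvPolynomial Set

variable {ι : Type*} [Fintype ι]

lemma exists_abs_eval_le_exp (P : MvPolynomial ι ℝ) :
    ∀ ε : ℝ, 0 < ε → ∃ C, ∀ y : EuclideanSpace ℝ ι,
      |eval y.ofLp P| ≤ C * Real.exp (ε * ‖y‖ ^ 2) := by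
  induction P using MvPolynomial.induction_on with
  | C a =>
    intro ε hε
    refine ⟨|a|, fun y ↦ ?_⟩
    simpa using le_mul_of_one_le_right (abs_nonneg a) (Real.one_le_exp (by positivity))
  | add p q hp hq =>
    intro ε hε
    obtain ⟨A, hA⟩ := hp ε hε
    obtain ⟨B, hB⟩ := hq ε hε
    refine ⟨A + B, fun y ↦ ?_⟩
    rw [map_add, add_mul]
    exact (abs_add_le _ _).trans (add_le_add (hA y) (hB y))
  | mul_X p i hp =>
    intro ε hε
    obtain ⟨A, hA⟩ := hp (ε / 2) (half_pos hε)
    refine ⟨A * (1 + 2 / ε), fun y ↦ ?_⟩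
    have hy : |y.ofLp i| ≤ (1 + 2 / ε) * Real.exp (ε / 2 * ‖y‖ ^ 2) := by
      calc |y.ofLp i| ≤ ‖y‖ := PiLp.norm_apply_le y i
        _ ≤ (1 + 2 / ε) * (ε / 2 * ‖y‖ ^ 2 + 1) := by
          have : (1 + 2 / ε) * (ε / 2 * ‖y‖ ^ 2 + 1) =
            1 + 2 / ε + ‖y‖ ^ 2 + ε / 2 * ‖y‖ ^ 2 := by field_simp; ring
          have : 0 < 2 / ε := by positivity
          have : 0 ≤ ε / 2 * ‖y‖ ^ 2 := by positivity
          nlinarith [sq_nonneg (‖y‖ - 1)]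
        _ ≤ _ := by gcongr; exact Real.add_one_le_exp _
    rw [map_mul, eval_X, abs_mul]
    calc _ ≤ (A * Real.exp (ε / 2 * ‖y‖ ^ 2)) * ((1 + 2 / ε) * Real.exp (ε / 2 * ‖y‖ ^ 2)) :=
          mul_le_mul (hA y) hy (abs_nonneg _) ((abs_nonneg _).trans (hA y))
      _ = A * (1 + 2 / ε) * (Real.exp (ε / 2 * ‖y‖ ^ 2) * Real.exp (ε / 2 * ‖y‖ ^ 2)) := by ring
      _ = _ := by rw [← Real.exp_add]; ring_nf

lemma integrable_exp_neg_mul_norm_sq {b : ℝ} (hb : 0 < b) :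
    Integrable fun y : EuclideanSpace ℝ ι ↦ Real.exp (-b * ‖y‖ ^ 2) := by
  have h := (GaussianFourier.integrable_cexp_neg_mul_sq_norm_add (b := (b : ℂ))
    (V := EuclideanSpace ℝ ι) (by simpa using hb) 0 0).norm
  refine h.congr (.of_forall fun y ↦ ?_)
  simp [Complex.norm_exp, ← Complex.ofReal_pow]

lemma continuous_eval_ofLp {ι : Type*} (P : MvPolynomial ι ℝ) :
    Continuous fun y : EuclideanSpace ℝ ι ↦ eval y.ofLp P :=
  P.continuous_eval.comp (PiLp.continuous_ofLp 2 _)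

lemma integrable_eval_mul_gaussian (P : MvPolynomial ι ℝ) :
    Integrable fun y : EuclideanSpace ℝ ι ↦ eval y.ofLp P * Real.exp (-(‖y‖ ^ 2 / 2)) := by
  obtain ⟨C, hC⟩ := exists_abs_eval_le_exp P (1 / 4) (by norm_num)
  refine ((integrable_exp_neg_mul_norm_sq (ι := ι) (b := 1 / 4) (by norm_num)).const_mul C).mono'
    (((continuous_eval_ofLp P).mul (by fun_prop)).aestronglyMeasurable) (.of_forall fun y ↦ ?_)
  rw [norm_mul, Real.norm_eq_abs, Real.norm_eq_abs, Real.abs_exp]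
  calc _ ≤ C * Real.exp (1 / 4 * ‖y‖ ^ 2) * Real.exp (-(‖y‖ ^ 2 / 2)) := by gcongr; exact hC y
    _ = _ := by rw [mul_assoc, ← Real.exp_add]; ring_nf

/-- Integration of a polynomial against the Gaussian weight `exp (-‖y‖² / 2)`. -/
noncomputable def gaussianFunctional : MvPolynomial ι ℝ →ₗ[ℝ] ℝ where
  toFun P := ∫ y : EuclideanSpace ℝ ι, eval y.ofLp P * Real.exp (-(‖y‖ ^ 2 / 2))
  map_add' P Q := by
    simp only [map_add, add_mul]
    exact integral_add (integrable_eval_mul_gaussian P) (integrable_eval_mul_gaussian Q)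
  map_smul' c P := by
    simp only [smul_eval, mul_assoc, RingHom.id_apply, smul_eq_mul]
    exact integral_const_mul _ _

lemma hasLineDerivAt_eval {ι : Type*} [DecidableEq ι] (P : MvPolynomial ι ℝ) (i : ι)
    (y : EuclideanSpace ℝ ι) :
    HasLineDerivAt ℝ (fun y : EuclideanSpace ℝ ι ↦ eval y.ofLp P) (eval y.ofLp (pderiv i P)) y
      (EuclideanSpace.single i 1) := by
  unfold HasLineDerivAt
  induction P using MvPolynomial.induction_on with
  | C a => simpa using hasDerivAt_const (0 : ℝ) a
  | add p q hp hq => simpa using hp.fun_add hq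
  | mul_X p j hp =>
    have hj : HasDerivAt (fun t : ℝ ↦ (y + t • EuclideanSpace.single i (1 : ℝ)).ofLp j)
        ((Pi.single i 1 : ι → ℝ) j) 0 := by
      have := ((hasDerivAt_id (0 : ℝ)).mul_const ((Pi.single i 1 : ι → ℝ) j)).const_add (y.ofLp j)
      simpa [Pi.single_apply] using this
    simp only [map_mul, eval_X]
    refine (hp.fun_mul hj).congr_deriv ?_
    simp only [Derivation.leibniz, pderiv_X, smul_eq_mul, map_add, map_mul, eval_X, zero_smul,
      add_zero]
    rw [Pi.single_apply, Pi.single_apply]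
    split_ifs <;> simp [mul_comm, add_comm]

lemma hasLineDerivAt_gaussian [DecidableEq ι] (i : ι) (y : EuclideanSpace ℝ ι) :
    HasLineDerivAt ℝ (fun y : EuclideanSpace ℝ ι ↦ Real.exp (-(‖y‖ ^ 2 / 2)))
      (-(y.ofLp i * Real.exp (-(‖y‖ ^ 2 / 2)))) y (EuclideanSpace.single i 1) := by
  have h : HasDerivAt (fun t : ℝ ↦ ‖y + t • EuclideanSpace.single i (1 : ℝ)‖ ^ 2)
      (2 * y.ofLp i) 0 := by
    simpa [HasLineDerivAt, EuclideanSpace.inner_single_right] using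
      (hasStrictFDerivAt_norm_sq y).hasFDerivAt.hasLineDerivAt
      (EuclideanSpace.single i (1 : ℝ))
  unfold HasLineDerivAt
  refine (h.div_const 2).fun_neg.exp.congr_deriv ?_
  rw [zero_smul, add_zero]
  ring

lemma gaussianFunctional_X_mul [DecidableEq ι] (i : ι) (P : MvPolynomial ι ℝ) :
    gaussianFunctional (X i * P) = gaussianFunctional (pderiv i P) := by
  have h := integral_bilinear_hasLineDerivAt_right_eq_neg_left_of_integrable
    (μ := (volume : Measure (EuclideanSpace ℝ ι)))
    (f := fun y ↦ eval y.ofLp P) (f' := fun y ↦ eval y.ofLp (pderiv i P))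
    (g := fun y ↦ Real.exp (-(‖y‖ ^ 2 / 2)))
    (g' := fun y ↦ -(y.ofLp i * Real.exp (-(‖y‖ ^ 2 / 2))))
    (B := ContinuousLinearMap.mul ℝ ℝ) (v := EuclideanSpace.single i 1)
    (by simpa using integrable_eval_mul_gaussian (pderiv i P))
    (by
      refine (integrable_eval_mul_gaussian (X i * P)).neg.congr (.of_forall fun y ↦ ?_)
      simp; ring)
    (by simpa using integrable_eval_mul_gaussian P)
    (fun y _ ↦ hasLineDerivAt_eval P i y) (fun y _ ↦ hasLineDerivAt_gaussian i y)
  simp only [ContinuousLinearMap.mul_apply', mul_neg, integral_neg, neg_inj] at h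
  simp only [gaussianFunctional, LinearMap.coe_mk, AddHom.coe_mk]
  rw [← h]
  refine integral_congr_ae (.of_forall fun y ↦ ?_)
  simp only [map_mul, eval_X]
  ring

end GaussianFunctional
section GaussianMoments
open Set

lemma integral_pow_mul_gaussian (k : ℕ) :
    ∫ r in Ioi (0 : ℝ), r ^ k * Real.exp (-(r ^ 2 / 2)) =
      (1 / 2 : ℝ) ^ (-(k + 1 : ℝ) / 2) * (1 / 2) * Real.Gamma ((k + 1 : ℝ) / 2) := by
  rw [← integral_rpow_mul_exp_neg_mul_rpow (p := 2) (q := k) (b := 1 / 2) two_pos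
    (by linarith [(k.cast_nonneg : (0 : ℝ) ≤ k)]) (by norm_num)]
  refine setIntegral_congr_fun measurableSet_Ioi fun r _ ↦ ?_
  simp only [Real.rpow_natCast, Real.rpow_two]
  ring_nf

lemma integral_pow_mul_gaussian_pos (k : ℕ) :
    0 < ∫ r in Ioi (0 : ℝ), r ^ k * Real.exp (-(r ^ 2 / 2)) := by
  rw [integral_pow_mul_gaussian]
  have := Real.Gamma_pos_of_pos (s := (k + 1 : ℝ) / 2) (by positivity)
  positivity

lemma integral_pow_add_two_mul_gaussian (k : ℕ) :
    ∫ r in Ioi (0 : ℝ), r ^ (k + 2) * Real.exp (-(r ^ 2 / 2)) =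
      (k + 1) * ∫ r in Ioi (0 : ℝ), r ^ k * Real.exp (-(r ^ 2 / 2)) := by
  rw [integral_pow_mul_gaussian, integral_pow_mul_gaussian]
  have h := Real.Gamma_add_one (s := (k + 1 : ℝ) / 2) (by positivity)
  have e : ((k + 2 : ℕ) + 1 : ℝ) / 2 = (k + 1 : ℝ) / 2 + 1 := by push_cast; ring
  have e' : -((k + 2 : ℕ) + 1 : ℝ) / 2 = -(k + 1 : ℝ) / 2 - 1 := by push_cast; ring
  rw [e, e', h, Real.rpow_sub_one (by norm_num)]
  ring

lemma integral_pow_two_mul_gaussian (n : ℕ) :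
    ∫ r in Ioi (0 : ℝ), r ^ (2 * n + 2) * Real.exp (-(r ^ 2 / 2)) =
      (∏ k ∈ Finset.range (n + 1), (2 * k + 1 : ℝ)) *
        ∫ r in Ioi (0 : ℝ), r ^ 0 * Real.exp (-(r ^ 2 / 2)) := by
  induction n with
  | zero => rw [integral_pow_add_two_mul_gaussian]; simp
  | succ n ih =>
    rw [show 2 * (n + 1) + 2 = 2 * n + 2 + 2 by ring, integral_pow_add_two_mul_gaussian, ih,
      Finset.prod_range_succ _ (n + 1)]
    push_cast
    ring

end GaussianMoments
section ReproducingKernel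

open MvPolynomial Set

lemma eval_smul_of_isHomogeneous {F : MvPolynomial (Fin 3) ℝ} {d : ℕ} (hF : F.IsHomogeneous d)
    (r : ℝ) (y : Fin 3 → ℝ) : eval (r • y) F = r ^ d * eval y F := by
  simp only [eval_eq, Finset.mul_sum, Pi.smul_apply, smul_eq_mul, mul_pow, Finset.prod_mul_distrib]
  refine Finset.sum_congr rfl fun m hm ↦ ?_
  rw [Finset.prod_pow_eq_pow_sum, ← hF.degree_eq_sum_deg_support hm]
  ring

lemma gaussianFunctional_eq_of_isHomogeneous {F : MvPolynomial (Fin 3) ℝ} {d : ℕ}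
    (hF : F.IsHomogeneous d) :
    gaussianFunctional F = (∫ ω, eval ω.1.ofLp F ∂sphereMeasure) *
      ∫ r in Ioi (0 : ℝ), r ^ (d + 2) * Real.exp (-(r ^ 2 / 2)) :=
  integral_homogeneous_mul_fun_norm (F := fun y ↦ eval y.ofLp F)
    (fun r _ y _ ↦ eval_smul_of_isHomogeneous hF r y.ofLp) fun r ↦ Real.exp (-(r ^ 2 / 2))

lemma sum_sq_eq_one_of_mem_sphere (x : Metric.sphere (0 : EuclideanSpace ℝ (Fin 3)) 1) :
    ∑ i, x.1.ofLp i ^ 2 = 1 := by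
  rw [← EuclideanSpace.real_norm_sq_eq, norm_eq_of_mem_sphere]
  norm_num

/-- The normalised zonal harmonic of degree `n` centred at `x` reproduces, up to a factor, the
spherical harmonics of degree `n`. -/
lemma integral_legendreP_mul {P : MvPolynomial (Fin 3) ℝ} {n : ℕ} (hP : P.IsHomogeneous n)
    (hP' : laplacian P = 0) (x : Metric.sphere (0 : EuclideanSpace ℝ (Fin 3)) 1) :
    ∫ ω, (legendreP n).eval (∑ i, x.1.ofLp i * ω.1.ofLp i) * eval ω.1.ofLp P ∂sphereMeasure =
      sphereMeasure.real univ / (2 * n + 1) * eval x.1.ofLp P := by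
  have hx := sum_sq_eq_one_of_mem_sphere x
  have h := map_zonal_mul (L := gaussianFunctional) gaussianFunctional_X_mul hx n hP hP'
  rw [gaussianFunctional_eq_of_isHomogeneous ((isHomogeneous_zonal _ n).mul hP),
    gaussianFunctional_eq_of_isHomogeneous (isHomogeneous_one _ _), ← two_mul,
    integral_pow_two_mul_gaussian, Finset.prod_range_succ,
    integral_pow_add_two_mul_gaussian 0] at h
  have hM := integral_pow_mul_gaussian_pos 0
  have hprod : 0 < ∏ k ∈ Finset.range n, (2 * k + 1 : ℝ) := by positivity
  simp only [map_mul, map_one, integral_const, smul_eq_mul, mul_one,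
    eval_zonal (sum_sq_eq_one_of_mem_sphere _)] at h
  have hn : (0 : ℝ) < 2 * n + 1 := by positivity
  rw [div_mul_eq_mul_div, eq_div_iff hn.ne']
  refine mul_right_cancel₀ (mul_pos hprod hM).ne' ?_
  push_cast at h
  linear_combination h

end ReproducingKernel

section CapEstimate

open Set

lemma integrable_slab_mul_one_add_norm {q : ℝ} (hq : 2 < q) {n : ℕ} (hn : 1 ≤ n) :
    Integrable (fun z : ℝ × (Fin 2 → ℝ) ↦
      (Icc (-1 : ℝ) 1).indicator (fun _ ↦ (1 : ℝ)) z.1 * (1 + ‖(n : ℝ) • z.2‖) ^ (-q)) := by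
  refine Integrable.mul_prod (μ := volume) (ν := volume)
    (f := (Icc (-1 : ℝ) 1).indicator fun _ ↦ (1 : ℝ))
    (g := fun w : Fin 2 → ℝ ↦ (1 + ‖(n : ℝ) • w‖) ^ (-q)) ?_ ?_
  · exact (integrable_indicator_iff measurableSet_Icc).2 (integrableOn_const (by simp))
  · have h : Integrable (fun w : Fin 2 → ℝ ↦ (1 + ‖w‖) ^ (-q)) :=
      integrable_one_add_norm (by simpa using hq)
    exact h.comp_smul (by positivity)

lemma integral_slab_mul_one_add_norm (q : ℝ) (n : ℕ) :
    ∫ z : ℝ × (Fin 2 → ℝ),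
      (Icc (-1 : ℝ) 1).indicator (fun _ ↦ (1 : ℝ)) z.1 * (1 + ‖(n : ℝ) • z.2‖) ^ (-q) =
      2 * (∫ w : Fin 2 → ℝ, (1 + ‖w‖) ^ (-q)) / n ^ 2 := by
  rw [Measure.volume_eq_prod,
    integral_prod_mul ((Icc (-1 : ℝ) 1).indicator fun _ ↦ (1 : ℝ))
    (fun w : Fin 2 → ℝ ↦ (1 + ‖(n : ℝ) • w‖) ^ (-q)),
    Measure.integral_comp_smul volume (fun w : Fin 2 → ℝ ↦ (1 + ‖w‖) ^ (-q)),
    integral_indicator measurableSet_Icc]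
  simp
  ring

/-- Coordinates adapted to the axis `x`: an axial coordinate and the two transverse ones. -/
lemma exists_measurePreserving_axis {x : EuclideanSpace ℝ (Fin 3)} (hx : ‖x‖ = 1) :
    ∃ Φ : EuclideanSpace ℝ (Fin 3) → ℝ × (Fin 2 → ℝ), MeasurePreserving Φ ∧
      ∀ y, (Φ y).1 = inner ℝ x y ∧ ‖(Φ y).2‖ ^ 2 ≤ ‖y‖ ^ 2 - inner ℝ x y ^ 2 := by
  obtain ⟨b, hb⟩ := Orthonormal.exists_orthonormalBasis_extension_of_card_eq (𝕜 := ℝ)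
    (E := EuclideanSpace ℝ (Fin 3)) (ι := Fin 3) (by simp) (v := fun _ ↦ x) (s := {0})
    (by
      rw [orthonormal_iff_ite]
      intro i j
      simp [Subsingleton.elim i j, hx, Set.domRestrict])
  refine ⟨fun y ↦ MeasurableEquiv.piFinSuccAbove (fun _ ↦ ℝ) 0 (b.repr y).ofLp,
    (volume_preserving_piFinSuccAbove (fun _ : Fin 3 ↦ ℝ) 0).comp
      ((PiLp.volume_preserving_ofLp (Fin 3)).comp b.measurePreserving_repr), fun y ↦ ?_⟩
  have h0 : (b.repr y).ofLp 0 = inner ℝ x y := by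
    rw [b.repr_apply_apply, hb 0 rfl]
  refine ⟨h0, ?_⟩
  have hn : ‖y‖ ^ 2 = inner ℝ x y ^ 2 + (b.repr y).ofLp 1 ^ 2 + (b.repr y).ofLp 2 ^ 2 := by
    rw [← b.repr.norm_map y, EuclideanSpace.real_norm_sq_eq, Fin.sum_univ_three, h0]
  have hw : ‖(fun i ↦ (b.repr y).ofLp (Fin.succ i) : Fin 2 → ℝ)‖ ≤
      √((b.repr y).ofLp 1 ^ 2 + (b.repr y).ofLp 2 ^ 2) := by
    refine (pi_norm_le_iff_of_nonneg (Real.sqrt_nonneg _)).2 fun i ↦ ?_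
    refine Real.abs_le_sqrt ?_
    fin_cases i
    · exact le_add_of_nonneg_right (sq_nonneg _)
    · exact le_add_of_nonneg_left (sq_nonneg _)
  calc ‖(fun i ↦ (b.repr y).ofLp (Fin.succ i) : Fin 2 → ℝ)‖ ^ 2
      ≤ √((b.repr y).ofLp 1 ^ 2 + (b.repr y).ofLp 2 ^ 2) ^ 2 := by gcongr
    _ = (b.repr y).ofLp 1 ^ 2 + (b.repr y).ofLp 2 ^ 2 := Real.sq_sqrt (by positivity)
    _ = _ := by linarith

lemma sq_sub_sq_le_one_sub_sq {t a : ℝ} (ht : 0 ≤ t) (ht' : t < 1) (ha : |a| ≤ t) :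
    t ^ 2 - a ^ 2 ≤ 1 - (t⁻¹ * a) ^ 2 := by
  rcases ht.eq_or_lt with rfl | h
  · simpa using (neg_nonpos.2 (sq_nonneg a)).trans zero_le_one
  have h1 : 0 ≤ t ^ 2 - a ^ 2 := sub_nonneg.2 (sq_le_sq.2 (by rwa [abs_of_pos h]))
  have h2 : 1 - (t⁻¹ * a) ^ 2 = (t ^ 2 - a ^ 2) / t ^ 2 := by field_simp
  rw [h2, le_div_iff₀ (by positivity)]
  exact mul_le_of_le_one_right h1 (by nlinarith)

/-- The decay away from the poles `± x` of the zonal harmonics makes them `L^q`-small. -/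
lemma exists_integral_axis_le {q : ℝ} (hq : 2 < q) :
    ∃ C : ℝ, 0 < C ∧ ∀ n : ℕ, 1 ≤ n → ∀ x : EuclideanSpace ℝ (Fin 3), ‖x‖ = 1 →
      ∫ ω, (1 + n * √(1 - inner ℝ x ω.1 ^ 2)) ^ (-q) ∂sphereMeasure ≤ C / n ^ 2 := by
  set I := ∫ w : Fin 2 → ℝ, (1 + ‖w‖) ^ (-q) with hI
  have hI0 : 0 ≤ I := integral_nonneg fun w ↦ by positivity
  refine ⟨6 * I + 1, by positivity, fun n hn x hx ↦ ?_⟩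
  obtain ⟨Φ, hΦ, hΦx⟩ := exists_measurePreserving_axis hx
  set φ : EuclideanSpace ℝ (Fin 3) → ℝ := fun y ↦ (1 + n * √(1 - inner ℝ x y ^ 2)) ^ (-q) with hφ
  set g : ℝ → ℝ := (Iio 1).indicator fun _ ↦ 1
  have hg : ∫ r in Ioi (0 : ℝ), r ^ (0 + 2) * g r = 1 / 3 := by
    have : (fun r : ℝ ↦ r ^ (0 + 2) * g r) = (Iio 1).indicator fun r ↦ r ^ 2 := by
      ext r; by_cases h : r ∈ Iio (1 : ℝ) <;> simp [g, h]
    rw [this, setIntegral_indicator measurableSet_Iio, Ioi_inter_Iio,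
      ← integral_Ioc_eq_integral_Ioo, ← intervalIntegral.integral_of_le zero_le_one, integral_pow]
    norm_num
  have hpolar := integral_homogeneous_mul_fun_norm (F := fun y ↦ φ (‖y‖⁻¹ • y)) (d := 0)
    (fun r hr y hy ↦ by
      simp only [norm_smul, hy, Real.norm_eq_abs, abs_of_pos hr, mul_one, inv_one, one_smul,
        inv_smul_smul₀ hr.ne', pow_zero, one_mul]) g
  have hsph : ∫ ω, φ (‖ω.1‖⁻¹ • ω.1) ∂sphereMeasure = ∫ ω, φ ω.1 ∂sphereMeasure := by
    simp only [norm_eq_of_mem_sphere, inv_one, one_smul]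
  rw [hg, hsph] at hpolar
  have hint := integrable_slab_mul_one_add_norm hq hn
  have hle : ∫ y, φ (‖y‖⁻¹ • y) * g ‖y‖ ≤ 2 * I / n ^ 2 := by
    rw [hI, ← integral_slab_mul_one_add_norm, ← hΦ.map_eq, integral_map hΦ.aemeasurable
      (hΦ.map_eq.symm ▸ hint.aestronglyMeasurable)]
    refine integral_mono_of_nonneg (.of_forall fun y ↦ ?_) (hΦ.integrable_comp_of_integrable hint)
      (.of_forall fun y ↦ ?_)
    · exact mul_nonneg (by positivity) (indicator_nonneg (by simp) _)
    · by_cases hy : ‖y‖ < 1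
      · have ha : |inner ℝ x y| ≤ ‖y‖ := by simpa [hx] using abs_real_inner_le_norm x y
        have h1 : (Φ y).1 ∈ Icc (-1 : ℝ) 1 := by
          rw [(hΦx y).1]
          exact abs_le.1 (ha.trans hy.le)
        have h2 : ‖(Φ y).2‖ ≤ √(1 - inner ℝ x (‖y‖⁻¹ • y) ^ 2) := by
          refine Real.le_sqrt_of_sq_le ((hΦx y).2.trans ?_)
          rw [inner_smul_right]
          exact sq_sub_sq_le_one_sub_sq (norm_nonneg y) hy ha
        simp only [g, hφ, indicator_of_mem h1, indicator_of_mem (mem_Iio.2 hy), mul_one, one_mul]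
        refine Real.rpow_le_rpow_of_nonpos (by positivity) ?_ (by linarith)
        rw [norm_smul, Real.norm_natCast]
        gcongr
      · simp only [g, indicator_of_notMem (show ‖y‖ ∉ Iio (1 : ℝ) from hy), mul_zero]
        exact mul_nonneg (indicator_nonneg (by simp) _) (by positivity)
  have : ∫ ω, φ ω.1 ∂sphereMeasure ≤ 6 * I / n ^ 2 := by
    rw [hpolar] at hle
    have : 6 * I / (n : ℝ) ^ 2 = 3 * (2 * I / n ^ 2) := by ring
    linarith
  refine this.trans ?_
  gcongr
  linarith

end CapEstimate

section ReproducingKernelBound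

open Function Set

lemma rpow_mul_rpow_mul_le {p : ℝ} (hp : 2 < p) {N A : ℝ} (hN : 0 < N) (hA : 0 < A) (u v k : ℝ) :
    (|u| ^ (p - 2) * u) * (|v| ^ (p - 2) * v) * k ≤ N ^ (2 - 2 / p) * A ^ (2 / p) *
      ((1 - 2 / p) * (|u| ^ p * |v| ^ p / N ^ 2) +
        2 / p * ((|u| ^ p * |k| ^ (p / 2) + |v| ^ p * |k| ^ (p / 2)) / (2 * N * A))) := by
  have hp0 : 0 < p := by linarith
  have hθ : 0 < 2 / p := by positivity
  have hθ' : 2 / p < 1 := (div_lt_one hp0).2 hp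
  have key (w : ℝ) : |w| ^ p = (|w| ^ (p / 2)) ^ 2 := by
    rw [← Real.rpow_mul_natCast (abs_nonneg w)]
    norm_num
  have abs_eq (w : ℝ) : |(|w| ^ (p - 2) * w)| = (|w| ^ (p / 2)) ^ (2 - 2 / p) := by
    rw [abs_mul, abs_of_nonneg (by positivity), ← Real.rpow_mul (abs_nonneg w),
      ← Real.rpow_add_one' (abs_nonneg w) (by linarith)]
    congr 1
    field_simp
    ring
  set U := |u| ^ (p / 2) with hU
  set V := |v| ^ (p / 2) with hV
  set k' := |k| ^ (p / 2) with hk'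
  have hU0 : 0 ≤ U := by positivity
  have hV0 : 0 ≤ V := by positivity
  have hk0 : 0 ≤ k' := by positivity
  have hk : |k| = k' ^ (2 / p) := by
    rw [hk', ← Real.rpow_mul (abs_nonneg k), show p / 2 * (2 / p) = 1 by field_simp, Real.rpow_one]
  have hmean := Real.geom_mean_le_arith_mean2_weighted (sub_nonneg.2 hθ'.le) hθ.le
    (p₁ := (U * V / N) ^ 2) (p₂ := U * V / N * (k' / A)) (by positivity) (by positivity)
    (by ring)
  have hUV : (U * V / N) ^ (2 - 2 / p) * (k' / A) ^ (2 / p) =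
      ((U * V / N) ^ 2) ^ (1 - 2 / p) * (U * V / N * (k' / A)) ^ (2 / p) := by
    have hc : 0 ≤ U * V / N := by positivity
    rw [Real.mul_rpow hc (by positivity), ← Real.rpow_two, ← Real.rpow_mul hc, ← mul_assoc,
      ← Real.rpow_add' hc (by linarith)]
    ring_nf
  rw [key u, key v]
  calc _ ≤ |(|u| ^ (p - 2) * u) * (|v| ^ (p - 2) * v) * k| := le_abs_self _
    _ = U ^ (2 - 2 / p) * V ^ (2 - 2 / p) * k' ^ (2 / p) := by
      rw [abs_mul, abs_mul, abs_eq, abs_eq, hk]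
    _ = N ^ (2 - 2 / p) * A ^ (2 / p) * ((U * V / N) ^ (2 - 2 / p) * (k' / A) ^ (2 / p)) := by
      rw [Real.div_rpow (by positivity) hN.le, Real.div_rpow hk0 hA.le, Real.mul_rpow hU0 hV0]
      have := (Real.rpow_pos_of_pos hN (2 - 2 / p)).ne'
      have := (Real.rpow_pos_of_pos hA (2 / p)).ne'
      field_simp
    _ ≤ _ := by
      rw [hUV]
      gcongr
      refine hmean.trans ?_
      have h1 : (U * V / N) ^ 2 = U ^ 2 * V ^ 2 / N ^ 2 := by ring
      have h2 : U * V / N * (k' / A) ≤ (U ^ 2 * k' + V ^ 2 * k') / (2 * N * A) := by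
        rw [div_mul_div_comm, div_le_div_iff₀ (by positivity) (by positivity)]
        have := mul_nonneg (mul_nonneg hk0 (mul_pos hN hA).le) (sq_nonneg (U - V))
        linarith
      rw [← h1]
      gcongr

variable {X : Type*} [TopologicalSpace X] [CompactSpace X] [MeasurableSpace X]
  [OpensMeasurableSpace X] {μ : Measure X} [IsFiniteMeasure μ]

lemma integrable_of_continuous {f : X → ℝ} (hf : Continuous f) : Integrable f μ :=
  hf.integrable_of_hasCompactSupport (.of_compactSpace f)

lemma continuous_integral_of_continuous [T2Space X] [FirstCountableTopology X]
    {f : X → X → ℝ} (hf : Continuous (uncurry f)) :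
    Continuous fun x ↦ ∫ y, f x y ∂μ := by
  simpa using continuous_parametric_integral_of_continuous (μ := μ) hf isCompact_univ

lemma integral_integral_swap_of_continuous {f : X → X → ℝ} (hf : Continuous (uncurry f)) :
    ∫ x, ∫ y, f x y ∂μ ∂μ = ∫ y, ∫ x, f x y ∂μ ∂μ :=
  integral_integral_swap_of_hasCompactSupport hf (.of_compactSpace _)

lemma sq_integral_mul_le {f g : X → ℝ} (hf : Continuous f) (hg : Continuous g) :
    (∫ x, f x * g x ∂μ) ^ 2 ≤ (∫ x, f x ^ 2 ∂μ) * ∫ x, g x ^ 2 ∂μ := by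
  have h := discrim_le_zero (a := ∫ x, f x ^ 2 ∂μ) (b := 2 * ∫ x, f x * g x ∂μ)
    (c := ∫ x, g x ^ 2 ∂μ) fun t ↦ by
      have : (∫ x, f x ^ 2 ∂μ) * (t * t) + (2 * ∫ x, f x * g x ∂μ) * t + ∫ x, g x ^ 2 ∂μ =
          ∫ x, (t * f x + g x) ^ 2 ∂μ := by
        have e : ∀ x, (t * f x + g x) ^ 2 =
          t * t * f x ^ 2 + 2 * t * (f x * g x) + g x ^ 2 := fun x ↦ by ring
        simp only [e]
        rw [integral_add, integral_add, integral_const_mul, integral_const_mul]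
        · ring
        all_goals exact integrable_of_continuous (by fun_prop)
      rw [this]
      exact integral_nonneg fun x ↦ sq_nonneg _
  rw [discrim] at h
  linarith

lemma integral_mul_integral_comm {K : X → X → ℝ} (hK : Continuous (uncurry K))
    (hsymm : ∀ x y, K x y = K y x) {f g : X → ℝ} (hf : Continuous f) (hg : Continuous g) :
    ∫ x, f x * ∫ y, K x y * g y ∂μ ∂μ = ∫ x, g x * ∫ y, K x y * f y ∂μ ∂μ := by
  simp only [← integral_const_mul]
  rw [integral_integral_swap_of_continuous (by fun_prop)]
  simp only [hsymm, mul_left_comm, mul_comm]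

/-- A `TT*` argument: an eigenfunction of a symmetric reproducing kernel `K` is controlled in `L^p`
by its `L²` norm and the `L^(p/2)` norms of the sections of `K`. -/
theorem integral_rpow_le_of_reproducing [T2Space X] [FirstCountableTopology X] {p : ℝ} (hp : 2 < p)
    {K : X → X → ℝ} {κ A : ℝ} (hκ : 0 < κ) (hA : 0 < A) (hK : Continuous (uncurry K))
    (hsymm : ∀ x y, K x y = K y x) (hKK : ∀ x z, ∫ y, K x y * K y z ∂μ = κ * K x z)
    (hKA : ∀ x, ∫ y, |K x y| ^ (p / 2) ∂μ ≤ A) {ψ : X → ℝ} (hψ : Continuous ψ)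
    (hψK : ∀ x, ∫ y, K x y * ψ y ∂μ = κ * ψ x) :
    κ * (∫ x, |ψ x| ^ p ∂μ) ^ (2 / p) ≤ A ^ (2 / p) * ∫ x, ψ x ^ 2 ∂μ := by
  have hp0 : 0 < p := by linarith
  set F : X → ℝ := fun x ↦ |ψ x| ^ p with hF
  set f : X → ℝ := fun x ↦ |ψ x| ^ (p - 2) * ψ x with hf
  set T : (X → ℝ) → X → ℝ := fun g x ↦ ∫ y, K x y * g y ∂μ with hT
  set N := ∫ x, F x ∂μ with hN
  have hFc : Continuous F := hψ.abs.rpow_const fun _ ↦ .inr hp0.le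
  have hfc : Continuous f := (hψ.abs.rpow_const fun _ ↦ .inr (by linarith)).mul hψ
  have hKp : Continuous (uncurry fun x y ↦ |K x y| ^ (p / 2)) :=
    hK.abs.rpow_const fun _ ↦ .inr (by linarith)
  have hTc : Continuous (T f) := continuous_integral_of_continuous (by fun_prop)
  have hN0 : 0 ≤ N := integral_nonneg fun x ↦ by positivity
  have hψ2 : 0 ≤ ∫ x, ψ x ^ 2 ∂μ := integral_nonneg fun x ↦ sq_nonneg _
  rcases hN0.eq_or_lt with h0 | hNpos
  · rw [← h0, Real.zero_rpow (by positivity), mul_zero]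
    positivity
  have hfψ (x : X) : f x * ψ x = F x := by
    rw [hf, hF]
    simp only
    rw [mul_assoc, ← sq, ← sq_abs, ← Real.rpow_natCast, ← Real.rpow_add' (abs_nonneg _)]
    · norm_num
    · norm_num; exact hp0.ne'
  have hpair : ∫ x, ψ x * T f x ∂μ = κ * N := by
    rw [hT, integral_mul_integral_comm hK hsymm hψ hfc]
    simp only [hψK]
    rw [hN, ← integral_const_mul]
    refine integral_congr_ae (.of_forall fun x ↦ ?_)
    simp only [← hfψ]
    ring
  have hTT (x : X) : T (T f) x = κ * T f x := by
    simp only [hT, ← integral_const_mul]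
    rw [integral_integral_swap_of_continuous (by fun_prop)]
    refine integral_congr_ae (.of_forall fun z ↦ ?_)
    simp only [← mul_assoc, ← hKK, integral_mul_const]
  have hsq : ∫ x, T f x ^ 2 ∂μ = κ * ∫ x, f x * T f x ∂μ := by
    have := integral_mul_integral_comm (μ := μ) hK hsymm hTc hfc
    simp only [sq]
    refine this.trans ?_
    rw [← integral_const_mul]
    refine integral_congr_ae (.of_forall fun x ↦ ?_)
    change f x * T (T f) x = _
    rw [hTT]
    ring
  have hbound : ∫ x, f x * T f x ∂μ ≤ N ^ (2 - 2 / p) * A ^ (2 / p) := by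
    set G : X → ℝ := fun x ↦ ∫ y, |K x y| ^ (p / 2) ∂μ with hG
    set H : X → ℝ := fun x ↦ ∫ y, F y * |K x y| ^ (p / 2) ∂μ with hH
    have hGc : Continuous G := continuous_integral_of_continuous hKp
    have hHK : Continuous (uncurry fun x y ↦ F y * |K x y| ^ (p / 2)) := by
      have : Continuous fun z : X × X ↦ F z.2 := by fun_prop
      exact this.mul hKp
    have hHc : Continuous H := continuous_integral_of_continuous hHK
    have hFG : ∫ x, F x * G x ∂μ ≤ N * A := by
      rw [hN, ← integral_mul_const]
      exact integral_mono (integrable_of_continuous (by fun_prop))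
        (integrable_of_continuous (by fun_prop))
        fun x ↦ mul_le_mul_of_nonneg_left (hKA x) (by positivity)
    have hH_eq : ∫ x, H x ∂μ = ∫ x, F x * G x ∂μ := by
      rw [hH, integral_integral_swap_of_continuous hHK]
      simp only [hG, ← integral_const_mul, hsymm]
    calc ∫ x, f x * T f x ∂μ
        ≤ ∫ x, N ^ (2 - 2 / p) * A ^ (2 / p) * ((1 - 2 / p) * (F x * N / N ^ 2) +
            2 / p * ((F x * G x + H x) / (2 * N * A))) ∂μ := by
          refine integral_mono (integrable_of_continuous (by fun_prop))
            (integrable_of_continuous (by fun_prop)) fun x ↦ ?_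
          have hKx : Continuous fun y ↦ |K x y| ^ (p / 2) :=
            hKp.comp (Continuous.prodMk_right x)
          have hKx' : Continuous (K x) := hK.comp (Continuous.prodMk_right x)
          have e : N ^ (2 - 2 / p) * A ^ (2 / p) * ((1 - 2 / p) * (F x * N / N ^ 2) +
              2 / p * ((F x * G x + H x) / (2 * N * A))) =
              ∫ y, N ^ (2 - 2 / p) * A ^ (2 / p) * ((1 - 2 / p) * (F x * F y / N ^ 2) +
              2 / p * ((F x * |K x y| ^ (p / 2) + F y * |K x y| ^ (p / 2)) / (2 * N * A))) ∂μ := by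
            rw [integral_const_mul, integral_add, integral_const_mul, integral_const_mul,
              integral_div, integral_div, integral_add, integral_const_mul, integral_const_mul]
            all_goals exact integrable_of_continuous (by fun_prop)
          simp only [e, hT, ← integral_const_mul]
          refine integral_mono (integrable_of_continuous (by fun_prop))
            (integrable_of_continuous (by fun_prop)) fun y ↦ ?_
          have := rpow_mul_rpow_mul_le hp hNpos hA (ψ x) (ψ y) (K x y)
          simp only [hf, hF]
          linarith
      _ = N ^ (2 - 2 / p) * A ^ (2 / p) * ((1 - 2 / p) +
            2 / p * (2 * ∫ x, F x * G x ∂μ) / (2 * N * A)) := by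
          rw [integral_const_mul, integral_add, integral_const_mul, integral_const_mul,
            integral_div, integral_div, integral_add, integral_mul_const, hH_eq, ← hN]
          · field_simp
            ring
          all_goals exact integrable_of_continuous (by fun_prop)
      _ ≤ N ^ (2 - 2 / p) * A ^ (2 / p) * 1 := by
          gcongr
          have : 2 / p * (2 * ∫ x, F x * G x ∂μ) / (2 * N * A) ≤ 2 / p := by
            rw [div_le_iff₀ (by positivity)]
            have : 0 < 2 / p := by positivity
            nlinarith
          linarith
      _ = _ := mul_one _
  have hCS := sq_integral_mul_le (μ := μ) hψ hTc
  rw [hpair, hsq] at hCS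
  have hNp : N ^ (2 : ℕ) = N ^ (2 / p) * N ^ (2 - 2 / p) := by
    rw [← Real.rpow_add hNpos, ← Real.rpow_natCast]
    norm_num
  have hpos : 0 < N ^ (2 - 2 / p) := by positivity
  refine le_of_mul_le_mul_right ?_ (mul_pos hκ hpos)
  calc κ * N ^ (2 / p) * (κ * N ^ (2 - 2 / p)) = (κ * N) ^ 2 := by rw [mul_pow, hNp]; ring
    _ ≤ _ := hCS
    _ ≤ (∫ x, ψ x ^ 2 ∂μ) * (κ * (N ^ (2 - 2 / p) * A ^ (2 / p))) := by gcongr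
    _ = _ := by ring

end ReproducingKernelBound

section SphericalHarmonics

open Set

/-- The zonal kernel `(x, y) ↦ P_n(⟨x, y⟩)` on the sphere. -/
noncomputable def zonalKernel (n : ℕ) (x y : Metric.sphere (0 : EuclideanSpace ℝ (Fin 3)) 1) : ℝ :=
  (legendreP n).eval (∑ i, x.1.ofLp i * y.1.ofLp i)

lemma continuous_zonalKernel (n : ℕ) : Continuous (Function.uncurry (zonalKernel n)) := by
  refine (legendreP n).continuous.comp (continuous_finsetSum _ fun i _ ↦ ?_)
  exact ((PiLp.continuous_apply 2 _ i).comp (continuous_subtype_val.comp continuous_fst)).mul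
    ((PiLp.continuous_apply 2 _ i).comp (continuous_subtype_val.comp continuous_snd))

lemma zonalKernel_comm (n : ℕ) (x y : Metric.sphere (0 : EuclideanSpace ℝ (Fin 3)) 1) :
    zonalKernel n x y = zonalKernel n y x := by
  simp only [zonalKernel, mul_comm]

lemma integral_zonalKernel_mul_zonalKernel (n : ℕ)
    (x z : Metric.sphere (0 : EuclideanSpace ℝ (Fin 3)) 1) :
    ∫ y, zonalKernel n x y * zonalKernel n y z ∂sphereMeasure =
      sphereMeasure.real univ / (2 * n + 1) * zonalKernel n x z := by
  have hz := sum_sq_eq_one_of_mem_sphere z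
  have h := integral_legendreP_mul (isHomogeneous_zonal z.1.ofLp n) (laplacian_zonal hz n) x
  simp only [eval_zonal (sum_sq_eq_one_of_mem_sphere _)] at h
  rw [zonalKernel_comm n x z]
  simp only [zonalKernel_comm n _ z]
  exact h

lemma abs_zonalKernel_rpow_le {n : ℕ} (hn : 1 ≤ n) {r : ℝ} (hr : 0 ≤ r)
    (x y : Metric.sphere (0 : EuclideanSpace ℝ (Fin 3)) 1) :
    |zonalKernel n x y| ^ (2 * r) ≤
      3 ^ r * (1 + n * √(1 - inner ℝ x.1 y.1 ^ 2)) ^ (-r) := by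
  have hinner : ∑ i, x.1.ofLp i * y.1.ofLp i = inner ℝ x.1 y.1 := by
    simp [PiLp.inner_apply, mul_comm]
  have ht : |inner ℝ x.1 y.1| ≤ 1 := by
    simpa using abs_real_inner_le_norm x.1 y.1
  have hD : 0 < 1 + n * √(1 - inner ℝ x.1 y.1 ^ 2) := by positivity
  rw [zonalKernel, hinner, Real.rpow_mul (abs_nonneg _), Real.rpow_two, sq_abs,
    Real.rpow_neg hD.le, ← div_eq_mul_inv, ← Real.div_rpow (by norm_num) hD.le]
  exact Real.rpow_le_rpow (sq_nonneg _) ((le_div_iff₀ hD).2 (legendreP_sq_mul_le hn ht)) hr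

lemma exists_integral_zonalKernel_le {r : ℝ} (hr : 2 < r) :
    ∃ C : ℝ, 0 < C ∧ ∀ n : ℕ, 1 ≤ n → ∀ x,
      ∫ y, |zonalKernel n x y| ^ (2 * r) ∂sphereMeasure ≤ C / n ^ 2 := by
  obtain ⟨C, hC, h⟩ := exists_integral_axis_le hr
  refine ⟨3 ^ r * C, by positivity, fun n hn x ↦ ?_⟩
  have hcont : Continuous fun y : Metric.sphere (0 : EuclideanSpace ℝ (Fin 3)) 1 ↦
      3 ^ r * (1 + n * √(1 - inner ℝ x.1 y.1 ^ 2)) ^ (-r) :=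
    continuous_const.mul (Continuous.rpow_const (by fun_prop) fun y ↦ .inl (by positivity))
  calc _ ≤ ∫ y, 3 ^ r * (1 + n * √(1 - inner ℝ x.1 y.1 ^ 2)) ^ (-r) ∂sphereMeasure :=
        integral_mono_of_nonneg (.of_forall fun y ↦ by positivity) (integrable_of_continuous hcont)
          (.of_forall fun y ↦ abs_zonalKernel_rpow_le hn (by linarith) x y)
    _ ≤ 3 ^ r * (C / n ^ 2) := by
        rw [integral_const_mul]
        gcongr
        exact h n hn x (norm_eq_of_mem_sphere x)
    _ = _ := by ring

end SphericalHarmonics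

theorem statement19 (p : ℝ) (hp : 8 < p) :
    ∃ C : ℝ, 0 < C ∧
      ∀ s : ℕ, 1 ≤ s → ∀ ψ : EuclideanSpace ℝ (Fin 3) → ℝ, IsSphericalHarmonic s ψ →
        sphLp p (fun x => ψ x) ≤ C * (s : ℝ) ^ ((1 : ℝ) / 2 - 2 / p) * sphLp 2 (fun x => ψ x) := by
  obtain ⟨B, hB, hKB⟩ := exists_integral_zonalKernel_le (r := p / 4) (by linarith)
  have hσ := sphereMeasure_real_univ_pos
  set σ := sphereMeasure.real Set.univ
  refine ⟨√(3 / σ * B ^ (2 / p)), by positivity, fun s hs ψ hψ ↦ ?_⟩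
  obtain ⟨P, hP, hP', hψP⟩ := hψ
  have hs1 : (1 : ℝ) ≤ s := by exact_mod_cast hs
  have hs0 : (0 : ℝ) < s := by linarith
  have hψc : Continuous fun x : Metric.sphere (0 : EuclideanSpace ℝ (Fin 3)) 1 ↦ ψ x := by
    simp only [hψP]
    exact (continuous_eval_ofLp P).comp continuous_subtype_val
  have hmain := integral_rpow_le_of_reproducing (p := p) (by linarith)
    (κ := σ / (2 * s + 1)) (A := B / s ^ 2) (by positivity) (by positivity)
    (continuous_zonalKernel s) (zonalKernel_comm s) (integral_zonalKernel_mul_zonalKernel s)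
    (fun x ↦ by
      rw [show p / 2 = 2 * (p / 4) by ring]
      exact hKB s hs x) hψc
    (fun x ↦ by
      simp only [hψP]
      exact integral_legendreP_mul hP hP' x)
  unfold sphLp
  simp only [Real.rpow_two, sq_abs]
  set N := ∫ x, |ψ x.1| ^ p ∂sphereMeasure
  set M := ∫ x, ψ x.1 ^ 2 ∂sphereMeasure
  have hN : 0 ≤ N := integral_nonneg fun x ↦ by positivity
  have hM : 0 ≤ M := integral_nonneg fun x ↦ sq_nonneg _
  refine (sq_le_sq₀ (by positivity) (by positivity)).1 ?_
  have hN2 : (N ^ (1 / p)) ^ 2 = N ^ (2 / p) := by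
    rw [← Real.rpow_mul_natCast hN]
    ring_nf
  have hs2 : ((s : ℝ) ^ (1 / 2 - 2 / p)) ^ 2 = s / ((s : ℝ) ^ 2) ^ (2 / p) := by
    rw [← Real.rpow_mul_natCast hs0.le, ← Real.rpow_natCast_mul hs0.le]
    nth_rewrite 2 [← Real.rpow_one (s : ℝ)]
    rw [← Real.rpow_sub hs0]
    push_cast
    ring_nf
  rw [mul_pow, mul_pow, Real.sq_sqrt (by positivity), hN2, hs2, ← Real.sqrt_eq_rpow,
    Real.sq_sqrt hM]
  rw [Real.div_rpow hB.le (by positivity)] at hmain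
  calc N ^ (2 / p) = (2 * s + 1) / σ * (σ / (2 * s + 1) * N ^ (2 / p)) := by field_simp
    _ ≤ (3 * s) / σ * (B ^ (2 / p) / ((s : ℝ) ^ 2) ^ (2 / p) * M) := by
        gcongr
        linarith
    _ = _ := by ring
end
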